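/- Let n ≥ 3 and let C_n be the cycle graph on n vertices. Then C_n is sequentially S_3 over a field k if and only if n = 3 or n = 5. -/

import Mathlib

open MvPolynomial

namespace SeqSr

/-! ### Abstract simplicial complexes -/

/-- An abstract simplicial complex on the vertex set `V`, viewed as a set of finite
subsets of `V` (its faces) closed under taking subsets. -/
def IsComplex {V : Type*} (Δ : Set (Finset V)) : Prop :=
  ∀ F ∈ Δ, ∀ G : Finset V, G ⊆ F → G ∈ Δ

/-- `Δ` is `(d-1)`-dimensional: every face has at most `d` vertices and
some face has exactly `d` vertices. -/
def HasDim {V : Type*} (Δ : Set (Finset V)) (d : ℕ) : Prop :=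
  (∀ F ∈ Δ, F.card ≤ d) ∧ ∃ F ∈ Δ, F.card = d

/-- A facet is a maximal face. -/
def IsFacet {V : Type*} (Δ : Set (Finset V)) (F : Finset V) : Prop :=
  F ∈ Δ ∧ ∀ G ∈ Δ, F ⊆ G → F = G

/-- A simplicial complex is pure if all facets have the same number of vertices. -/
def IsPure {V : Type*} (Δ : Set (Finset V)) : Prop :=
  ∀ F G : Finset V, IsFacet Δ F → IsFacet Δ G → F.card = G.card

/-- The link of a face `F` of `Δ`:
`lk_Δ F = {G : F ∩ G = ∅ and F ∪ G ∈ Δ}`. -/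
def link {V : Type*} [DecidableEq V] (Δ : Set (Finset V)) (F : Finset V) :
    Set (Finset V) :=
  {G | F ∩ G = ∅ ∧ F ∪ G ∈ Δ}

/-- The `i`-skeleton of `Δ`: all faces of dimension at most `i`
(i.e. with at most `i + 1` vertices). -/
def skeleton {V : Type*} (Δ : Set (Finset V)) (i : ℕ) : Set (Finset V) :=
  {F ∈ Δ | F.card ≤ i + 1}

/-- The pure `i`-skeleton of `Δ`: the subcomplex generated by the `i`-dimensional
faces of `Δ` (here `i : ℤ`, so that `i = -1` makes sense). -/
def pureSkeleton {V : Type*} (Δ : Set (Finset V)) (i : ℤ) : Set (Finset V) :=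
  {F | ∃ G ∈ Δ, (G.card : ℤ) = i + 1 ∧ F ⊆ G}

/-- A simplicial complex is connected if any two of its vertices can be joined by a
path of `1`-dimensional faces. -/
def IsConnectedComplex {V : Type*} [DecidableEq V] (Δ : Set (Finset V)) : Prop :=
  ∀ x y : V, {x} ∈ Δ → {y} ∈ Δ →
    Relation.ReflTransGen (fun a b : V => ({a, b} : Finset V) ∈ Δ) x y

/-! ### Stanley-Reisner rings -/

/-- The Stanley-Reisner ideal of `Δ` in the polynomial ring `k[x_v : v ∈ V]`:
the ideal generated by the squarefree monomials corresponding to non-faces of `Δ`. -/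
noncomputable def srIdeal (k : Type*) [Field k] {V : Type*} (Δ : Set (Finset V)) :
    Ideal (MvPolynomial V k) :=
  Ideal.span {m | ∃ F : Finset V, F ∉ Δ ∧ m = ∏ i ∈ F, X i}

/-! ### Depth, dimension and Serre's condition for modules -/

/-- The depth of `M` with respect to the ideal `I`: the supremum of the lengths of
`M`-regular sequences consisting of elements of `I`.  (For a finitely generated
module over a Noetherian local ring, taking `I` to be the maximal ideal recovers the
usual depth.) -/
noncomputable def depthIn (A : Type*) [CommRing A] (I : Ideal A) (M : Type*)
    [AddCommGroup M] [Module A M] : ℕ∞ :=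
  sSup {n : ℕ∞ | ∃ rs : List A, (∀ x ∈ rs, x ∈ I) ∧
    RingTheory.Sequence.IsRegular M rs ∧ (rs.length : ℕ∞) = n}

/-- The (Krull) dimension of a module `M` over `A`: the Krull dimension of the ring
`A` modulo the annihilator of `M`. -/
noncomputable def mDim (A : Type*) [CommRing A] (M : Type*)
    [AddCommGroup M] [Module A M] : WithBot ℕ∞ :=
  ringKrullDim (A ⧸ Module.annihilator A M)

/-- Serre's condition `S_r` for a module `M` over `A`: for every prime ideal `p`,
`depth M_p ≥ min (r, dim M_p)`. -/
def IsSerreMod (r : ℕ) (A : Type*) [CommRing A] (M : Type*)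
    [AddCommGroup M] [Module A M] : Prop :=
  ∀ (p : Ideal A) [p.IsPrime],
    min ((r : ℕ∞) : WithBot ℕ∞)
        (mDim (Localization p.primeCompl) (LocalizedModule p.primeCompl M)) ≤
      ((depthIn (Localization p.primeCompl)
          (Ideal.map (algebraMap A (Localization p.primeCompl)) p)
          (LocalizedModule p.primeCompl M) : ℕ∞) : WithBot ℕ∞)

/-- A module `M` over `A` is Cohen-Macaulay if `depth M_p ≥ dim M_p` for every
prime ideal `p` (the reverse inequality being automatic). -/
def IsCMMod (A : Type*) [CommRing A] (M : Type*) [AddCommGroup M] [Module A M] : Prop :=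
  ∀ (p : Ideal A) [p.IsPrime],
    mDim (Localization p.primeCompl) (LocalizedModule p.primeCompl M) ≤
      ((depthIn (Localization p.primeCompl)
          (Ideal.map (algebraMap A (Localization p.primeCompl)) p)
          (LocalizedModule p.primeCompl M) : ℕ∞) : WithBot ℕ∞)

/-- `Δ` satisfies Serre's condition `S_r` over `k` if its Stanley-Reisner ring
`k[Δ]` does, as a module over the polynomial ring. -/
def IsSerreComplex (k : Type*) [Field k] {V : Type*} (Δ : Set (Finset V)) (r : ℕ) :
    Prop :=
  IsSerreMod r (MvPolynomial V k) (MvPolynomial V k ⧸ srIdeal k Δ)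

/-! ### Sequentially `S_r` and sequentially Cohen-Macaulay complexes -/

/-- A homogeneous ideal of the polynomial ring (with respect to the standard
grading): an ideal containing all homogeneous components of its elements. -/
def IsHomogeneousIdeal (k : Type*) [Field k] {V : Type*}
    (J : Ideal (MvPolynomial V k)) : Prop :=
  ∀ f ∈ J, ∀ i : ℕ, homogeneousComponent i f ∈ J

/-- For ideals `J ⊆ J'` of `A`, the subquotient `J'/J` as an `A`-module. -/
abbrev subquot {A : Type*} [CommRing A] (J J' : Ideal A) : Type _ :=
  ↥J' ⧸ Submodule.comap J'.subtype J

/-- `Δ` is sequentially `S_r` over `k`: there is a finite filtration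
`0 = M_0 ⊂ M_1 ⊂ ⋯ ⊂ M_t = k[Δ]` of `k[Δ]` by graded submodules such that each
quotient `M_i/M_{i-1}` satisfies Serre's condition `S_r` and the (Krull) dimensions
of the quotients are strictly increasing.  Since `k[Δ]` is a cyclic module generated
in degree `0`, its graded submodules are exactly the images of homogeneous ideals
`J ⊇ I_Δ`, and `M_i/M_{i-1} = J_i/J_{i-1}`; we state the definition this way. -/
def IsSeqSerre (k : Type*) [Field k] {V : Type*} (Δ : Set (Finset V)) (r : ℕ) : Prop :=
  ∃ (t : ℕ) (J : ℕ → Ideal (MvPolynomial V k)),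
    J 0 = srIdeal k Δ ∧ J t = ⊤ ∧
    (∀ i ≤ t, IsHomogeneousIdeal k (J i)) ∧
    (∀ i < t, J i < J (i + 1)) ∧
    (∀ i < t, IsSerreMod r (MvPolynomial V k) (subquot (J i) (J (i + 1)))) ∧
    (∀ i : ℕ, i + 2 ≤ t →
      mDim (MvPolynomial V k) (subquot (J i) (J (i + 1))) <
        mDim (MvPolynomial V k) (subquot (J (i + 1)) (J (i + 2))))

/-- `Δ` is sequentially Cohen-Macaulay over `k`: there is a finite filtration
`0 = M_0 ⊂ M_1 ⊂ ⋯ ⊂ M_t = k[Δ]` by graded submodules with Cohen-Macaulay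
quotients of strictly increasing dimensions. -/
def IsSeqCM (k : Type*) [Field k] {V : Type*} (Δ : Set (Finset V)) : Prop :=
  ∃ (t : ℕ) (J : ℕ → Ideal (MvPolynomial V k)),
    J 0 = srIdeal k Δ ∧ J t = ⊤ ∧
    (∀ i ≤ t, IsHomogeneousIdeal k (J i)) ∧
    (∀ i < t, J i < J (i + 1)) ∧
    (∀ i < t, IsCMMod (MvPolynomial V k) (subquot (J i) (J (i + 1)))) ∧
    (∀ i : ℕ, i + 2 ≤ t →
      mDim (MvPolynomial V k) (subquot (J i) (J (i + 1))) <
        mDim (MvPolynomial V k) (subquot (J (i + 1)) (J (i + 2))))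

/-! ### Graphs -/

/-- The independence complex of a graph `G`: faces are the independent sets. -/
def indepComplex {V : Type*} (G : SimpleGraph V) : Set (Finset V) :=
  {F | ∀ x ∈ F, ∀ y ∈ F, ¬ G.Adj x y}

/-! ### Face primes -/

section FacePrime

variable {k : Type*} [Field k] {V : Type*}

/-- The prime ideal generated by the variables outside `F`. -/
noncomputable def facePrime (k : Type*) [Field k] {V : Type*} (F : Finset V) :
    Ideal (MvPolynomial V k) :=
  Ideal.span (X '' {i | i ∉ F})

lemma mem_facePrime {F : Finset V} {f : MvPolynomial V k} :
    f ∈ facePrime k F ↔ ∀ m : V →₀ ℕ, m.support ⊆ F → coeff m f = 0 := by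
  rw [facePrime, mem_ideal_span_X_image]
  refine forall_congr' fun m => ?_
  rw [mem_support_iff, ← not_imp_not, not_not]
  refine imp_congr_left ?_
  simp only [Set.mem_ofPred_eq, not_exists, not_and, not_not, Finset.subset_iff,
    Finsupp.mem_support_iff]
  exact forall_congr' fun i => ⟨fun h h' => by_contra fun h'' => h' (h h''),
    fun h h' => by_contra fun h'' => h' (h h'')⟩

lemma facePrime_eq_ker (F : Finset V) :
    facePrime k F = RingHom.ker
      (killCompl (R := k) (Subtype.val_injective (p := (· ∈ F)))) := by
  classical
  ext f
  rw [mem_facePrime, RingHom.mem_ker, MvPolynomial.ext_iff]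
  simp only [coeff_killCompl, coeff_zero]
  constructor
  · intro h m
    refine h _ fun i hi => ?_
    obtain ⟨j, -, rfl⟩ := Finset.mem_image.1 (Finsupp.mapDomain_support hi)
    exact j.2
  · intro h m hm
    have := h (m.comapDomain Subtype.val Subtype.val_injective.injOn)
    rwa [Finsupp.mapDomain_comapDomain _ Subtype.val_injective] at this
    intro i hi
    exact ⟨⟨i, hm hi⟩, rfl⟩

lemma killCompl_surjective (F : Finset V) : Function.Surjective
    (killCompl (R := k) (Subtype.val_injective (p := (· ∈ F)))) :=
  fun g => ⟨_, killCompl_rename_app _ g⟩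

instance facePrime_isPrime (F : Finset V) : (facePrime k F).IsPrime := by
  rw [facePrime_eq_ker]
  exact RingHom.ker_isPrime _

lemma ringKrullDim_quotient_facePrime (F : Finset V) :
    ringKrullDim (MvPolynomial V k ⧸ facePrime k F) = F.card := by
  rw [ringKrullDim_eq_of_ringEquiv ((Ideal.quotEquivOfEq (facePrime_eq_ker F)).trans
    (RingHom.quotientKerEquivOfSurjective (killCompl_surjective F)))]
  simp

lemma X_mem_facePrime {F : Finset V} {i : V} :
    (X i : MvPolynomial V k) ∈ facePrime k F ↔ i ∉ F := by
  classical
  rw [mem_facePrime]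
  constructor
  · intro h hi
    simpa using h (Finsupp.single i 1) (Finsupp.support_single_subset.trans (by simpa))
  · intro hi m hm
    rw [coeff_X, if_neg]
    rintro rfl
    exact hi (hm (by simp))

lemma facePrime_le_iff {F : Finset V} {Q : Ideal (MvPolynomial V k)} :
    facePrime k F ≤ Q ↔ ∀ i ∉ F, X i ∈ Q := by
  rw [facePrime, Ideal.span_le]
  exact Set.image_subset_iff

lemma facePrime_anti {F G : Finset V} (h : F ⊆ G) : facePrime k G ≤ facePrime k F :=
  facePrime_le_iff.2 fun _ hi => X_mem_facePrime.2 fun h' => hi (h h')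

lemma facePrime_erase [DecidableEq V] (F : Finset V) (i : V) :
    facePrime k (F.erase i) = facePrime k F ⊔ Ideal.span {X i} := by
  refine le_antisymm (facePrime_le_iff.2 fun j hj => ?_)
    (sup_le (facePrime_anti (F.erase_subset i)) ?_)
  · by_cases hji : j = i
    · subst hji
      exact Ideal.mem_sup_right (Ideal.mem_span_singleton_self _)
    · exact Ideal.mem_sup_left (X_mem_facePrime.2 fun h => hj (Finset.mem_erase.2 ⟨hji, h⟩))
  · rw [Ideal.span_singleton_le_iff_mem]
    exact X_mem_facePrime.2 (Finset.notMem_erase i F)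

lemma facePrime_erase_lt [DecidableEq V] {F : Finset V} {i : V} (hi : i ∈ F) :
    facePrime k F < facePrime k (F.erase i) :=
  lt_of_le_not_ge (facePrime_anti (F.erase_subset i)) fun h =>
    X_mem_facePrime.1 (h (X_mem_facePrime.2 (Finset.notMem_erase i F))) hi

lemma mem_facePrime_empty {f : MvPolynomial V k} :
    f ∈ facePrime k (∅ : Finset V) ↔ constantCoeff f = 0 := by
  simp [mem_facePrime, constantCoeff_eq]

lemma prod_X_mem_iff {F : Finset V} {Q : Ideal (MvPolynomial V k)} [Q.IsPrime] :
    ∏ i ∈ F, X i ∈ Q ↔ ∃ i ∈ F, X i ∈ Q :=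
  Ideal.IsPrime.prod_mem_iff

lemma prod_X_notMem_facePrime (F : Finset V) :
    (∏ i ∈ F, X i : MvPolynomial V k) ∉ facePrime k F := by
  rw [prod_X_mem_iff]
  rintro ⟨i, hi, h⟩
  exact X_mem_facePrime.1 h hi

lemma isHomogeneousIdeal_facePrime (F : Finset V) : IsHomogeneousIdeal k (facePrime k F) := by
  intro f hf i
  rw [mem_facePrime] at hf ⊢
  intro m hm
  rw [coeff_homogeneousComponent, hf m hm, ite_self]

variable {Δ : Set (Finset V)}

lemma srIdeal_le_facePrime (hΔ : IsComplex Δ) {F : Finset V} (hF : F ∈ Δ) :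
    srIdeal k Δ ≤ facePrime k F := by
  rw [srIdeal, Ideal.span_le]
  rintro _ ⟨G, hG, rfl⟩
  have : ¬ G ⊆ F := fun h => hG (hΔ F hF G h)
  obtain ⟨i, hiG, hiF⟩ := Finset.not_subset.1 this
  exact prod_X_mem_iff.2 ⟨i, hiG, X_mem_facePrime.2 hiF⟩

lemma exists_face_of_srIdeal_le [Finite V] {Q : Ideal (MvPolynomial V k)} [Q.IsPrime]
    (h : srIdeal k Δ ≤ Q) : ∃ F ∈ Δ, ∀ i, i ∈ F ↔ X i ∉ Q := by
  classical
  have := Fintype.ofFinite V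
  refine ⟨Finset.univ.filter fun i => X i ∉ Q, ?_, by simp⟩
  by_contra hF
  obtain ⟨i, hi, hiQ⟩ := prod_X_mem_iff.1 (h (Ideal.subset_span ⟨_, hF, rfl⟩))
  exact (Finset.mem_filter.1 hi).2 hiQ

lemma prod_X_mul_mem_srIdeal {F : Finset V} (hF : ∀ G ∈ Δ, G.card ≤ F.card)
    {f : MvPolynomial V k} (hf : f ∈ facePrime k F) : (∏ i ∈ F, X i) * f ∈ srIdeal k Δ := by
  classical
  rw [facePrime] at hf
  induction hf using Submodule.span_induction with
  | mem x hx =>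
    obtain ⟨i, hi, rfl⟩ := hx
    rw [mul_comm, ← Finset.prod_insert hi]
    refine Ideal.subset_span ⟨_, fun h => ?_, rfl⟩
    have := hF _ h
    rw [Finset.card_insert_of_notMem hi] at this
    omega
  | zero => simp
  | add x y _ _ hx hy => rw [mul_add]; exact add_mem hx hy
  | smul a x _ hx => rw [smul_eq_mul, mul_left_comm]; exact Ideal.mul_mem_left _ _ hx

lemma ringKrullDim_quotient_srIdeal_le [Finite V] {d : ℕ} (hd : ∀ F ∈ Δ, F.card ≤ d) :
    ringKrullDim (MvPolynomial V k ⧸ srIdeal k Δ) ≤ d := by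
  rw [ringKrullDim_quotient]
  refine iSup_le fun p => ?_
  obtain ⟨F, hF, hFQ⟩ := exists_face_of_srIdeal_le (Δ := Δ) (Q := p.head.1.asIdeal) p.head.2
  have hle : facePrime k F ≤ p.head.1.asIdeal :=
    facePrime_le_iff.2 fun i hi => not_not.1 fun h => hi ((hFQ i).2 h)
  let q : LTSeries (PrimeSpectrum.zeroLocus (facePrime k F : Set (MvPolynomial V k))) :=
    { length := p.length
      toFun := fun i => ⟨(p i).1, hle.trans (p.head_le i)⟩
      step := fun i => p.step i }
  refine le_trans ?_ (((ringKrullDim_quotient_facePrime (k := k) F).le).trans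
    (by exact_mod_cast hd F hF))
  rw [ringKrullDim_quotient]
  exact le_iSup (fun p : LTSeries (PrimeSpectrum.zeroLocus
    (facePrime k F : Set (MvPolynomial V k))) => (p.length : WithBot ℕ∞)) q

end FacePrime

/-! ### Serre's condition for cyclic modules in terms of ideals -/

section Extract

variable {R : Type*} [CommRing R]

/-- Multiplication by `a` is injective on `R ⧸ N` locally at `p`. -/
def LocReg (p N : Ideal R) (a : R) : Prop :=
  ∀ z, a * z ∈ N → ∃ s ∉ p, s * z ∈ N

/-- The generator of the cyclic module `R ⧸ J`, localized at `p`. -/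
noncomputable def cyclicGen (J p : Ideal R) [p.IsPrime] :
    LocalizedModule p.primeCompl (subquot J ⊤) :=
  LocalizedModule.mkLinearMap p.primeCompl _ (Submodule.Quotient.mk ⟨1, trivial⟩)

lemma smul_cyclicGen_eq_zero_iff {J p : Ideal R} [p.IsPrime] {z : Localization p.primeCompl} :
    z • cyclicGen J p = 0 ↔ z ∈ J.map (algebraMap R (Localization p.primeCompl)) := by
  obtain ⟨r, s, rfl⟩ := IsLocalization.exists_mk'_eq p.primeCompl z
  rw [IsLocalization.mk'_mem_map_algebraMap_iff, cyclicGen]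
  have hu := IsLocalization.map_units (Localization p.primeCompl) s
  rw [← hu.smul_eq_zero, smul_smul, mul_comm, IsLocalization.mk'_spec, algebraMap_smul, ← map_smul,
    ← map_zero (LocalizedModule.mkLinearMap p.primeCompl _),
    IsLocalizedModule.eq_iff_exists p.primeCompl]
  constructor
  · rintro ⟨c, hc⟩
    rw [smul_zero] at hc
    refine ⟨c, c.2, ?_⟩
    have := (Submodule.Quotient.mk_eq_zero _).1 hc
    simpa [Submodule.mem_comap] using this
  · rintro ⟨c, hc, h⟩
    refine ⟨⟨c, hc⟩, ?_⟩
    rw [smul_zero]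
    refine (Submodule.Quotient.mk_eq_zero _).2 ?_
    simpa [Submodule.mem_comap, Submonoid.smul_def] using h

lemma exists_eq_smul_cyclicGen {J p : Ideal R} [p.IsPrime]
    (m : LocalizedModule p.primeCompl (subquot J ⊤)) :
    ∃ z : Localization p.primeCompl, m = z • cyclicGen J p := by
  induction m using LocalizedModule.induction_on with
  | h m s =>
    obtain ⟨⟨r, -⟩, rfl⟩ := Submodule.Quotient.mk_surjective _ m
    refine ⟨Localization.mk r s, ?_⟩
    rw [cyclicGen, LocalizedModule.mkLinearMap_apply, LocalizedModule.mk_smul_mk, mul_one]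
    congr 1
    rw [← Submodule.Quotient.mk_smul]
    congr 1
    ext
    simp

lemma smul_cyclicGen_mem_iff {J p : Ideal R} [p.IsPrime] {z : Localization p.primeCompl}
    {I : Ideal (Localization p.primeCompl)} :
    z • cyclicGen J p ∈ (I • ⊤ : Submodule (Localization p.primeCompl)
      (LocalizedModule p.primeCompl (subquot J ⊤))) ↔
      z ∈ I ⊔ J.map (algebraMap R (Localization p.primeCompl)) := by
  have htop : (⊤ : Submodule (Localization p.primeCompl)
      (LocalizedModule p.primeCompl (subquot J ⊤))) = Submodule.span _ {cyclicGen J p} := by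
    refine (Submodule.eq_top_iff'.2 fun m => ?_).symm
    obtain ⟨z, rfl⟩ := exists_eq_smul_cyclicGen m
    exact Submodule.smul_mem _ _ (Submodule.mem_span_singleton_self _)
  rw [htop, Submodule.mem_smul_span_singleton]
  constructor
  · rintro ⟨y, hy, h⟩
    rw [← sub_eq_zero, ← sub_smul, smul_cyclicGen_eq_zero_iff] at h
    rw [← sub_sub_cancel y z]
    exact sub_mem (Ideal.mem_sup_left hy) (Ideal.mem_sup_right h)
  · intro h
    obtain ⟨y, hy, w, hw, rfl⟩ := Submodule.mem_sup.1 h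
    exact ⟨y, hy, by rw [add_smul, smul_cyclicGen_eq_zero_iff.2 hw, add_zero]⟩

lemma mDim_cyclic (J p : Ideal R) [p.IsPrime] :
    mDim (Localization p.primeCompl) (LocalizedModule p.primeCompl (subquot J ⊤)) =
      ringKrullDim (Localization p.primeCompl ⧸
        J.map (algebraMap R (Localization p.primeCompl))) := by
  have : Module.annihilator (Localization p.primeCompl)
      (LocalizedModule p.primeCompl (subquot J ⊤)) =
      J.map (algebraMap R (Localization p.primeCompl)) := by
    ext z
    rw [Module.mem_annihilator, ← smul_cyclicGen_eq_zero_iff]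
    refine ⟨fun h => h _, fun h m => ?_⟩
    obtain ⟨y, rfl⟩ := exists_eq_smul_cyclicGen m
    rw [smul_comm, h, smul_zero]
  rw [mDim, this]

lemma le_ringKrullDim_localization_quotient {J p : Ideal R} [p.IsPrime]
    (c : LTSeries (PrimeSpectrum R)) (hJ : J ≤ c.head.asIdeal) (hp : c.last.asIdeal ≤ p) :
    (c.length : WithBot ℕ∞) ≤ ringKrullDim (Localization p.primeCompl ⧸
        J.map (algebraMap R (Localization p.primeCompl))) := by
  rw [ringKrullDim_quotient]
  let e := IsLocalization.AtPrime.primeSpectrumOrderIso (Localization p.primeCompl) p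
  have hcp (i) : c i ∈ Set.Iic (⟨p, inferInstance⟩ : PrimeSpectrum R) :=
    le_trans (c.monotone (Fin.le_last i)) hp
  let q : LTSeries (PrimeSpectrum.zeroLocus
      (J.map (algebraMap R (Localization p.primeCompl)) : Set (Localization p.primeCompl))) :=
    { length := c.length
      toFun := fun i => ⟨e.symm ⟨c i, hcp i⟩, by
        rw [PrimeSpectrum.mem_zeroLocus, SetLike.coe_subset_coe, Ideal.map_le_iff_le_comap]
        have : (e (e.symm ⟨c i, hcp i⟩)).1 = c i := by rw [OrderIso.apply_symm_apply]
        have h2 : (e.symm ⟨c i, hcp i⟩).asIdeal.comap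
          (algebraMap R (Localization p.primeCompl)) = (c i).asIdeal :=
          (show _ = (e (e.symm ⟨c i, hcp i⟩)).1.asIdeal from rfl).trans
            (congrArg PrimeSpectrum.asIdeal this)
        rw [h2]
        exact hJ.trans (c.head_le i)⟩
      step := fun i => e.symm.lt_iff_lt.2 (c.step i) }
  exact le_iSup (fun p : LTSeries (PrimeSpectrum.zeroLocus
      (J.map (algebraMap R (Localization p.primeCompl)) : Set (Localization p.primeCompl))) =>
        (p.length : WithBot ℕ∞)) q

lemma exists_list_of_le_depthIn {A : Type*} [CommRing A] {I : Ideal A} {M : Type*} [AddCommGroup M]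
    [Module A M] {l : ℕ} (h : (l : ℕ∞) ≤ depthIn A I M) :
    ∃ rs : List A, (∀ x ∈ rs, x ∈ I) ∧ RingTheory.Sequence.IsRegular M rs ∧ l ≤ rs.length ∨
      l = 0 := by
  by_contra! hc
  obtain ⟨hl, hc⟩ : l ≠ 0 ∧ ∀ rs : List A, (∀ x ∈ rs, x ∈ I) →
    RingTheory.Sequence.IsRegular M rs → rs.length < l := by
    exact ⟨(hc []).2, fun rs => (hc rs).1⟩
  have : depthIn A I M ≤ ((l - 1 : ℕ) : ℕ∞) := by
    refine sSup_le ?_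
    rintro _ ⟨rs, h1, h2, rfl⟩
    have := hc rs h1 h2
    exact_mod_cast (by omega : rs.length ≤ l - 1)
  have := h.trans this
  have : l ≤ l - 1 := by exact_mod_cast this
  omega

lemma IsSerreMod.exists_locReg {J : Ideal R} {r : ℕ} (h : IsSerreMod r R (subquot J ⊤))
    (p : Ideal R) [p.IsPrime] (c : LTSeries (PrimeSpectrum R)) (hJ : J ≤ c.head.asIdeal)
    (hp : c.last.asIdeal ≤ p) {l : ℕ} (hlr : l ≤ r) (hlc : l ≤ c.length) :
    ∃ a : ℕ → R, (∀ i < l, a i ∈ p) ∧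
      ∀ i < l, LocReg p (J ⊔ Ideal.span (a '' {j | j < i})) (a i) := by
  have hd := h p
  rw [mDim_cyclic] at hd
  have h1 : (l : WithBot ℕ∞) ≤ _ := (le_min (by exact_mod_cast hlr)
    ((by exact_mod_cast hlc : (l : WithBot ℕ∞) ≤ c.length).trans
      (le_ringKrullDim_localization_quotient c hJ hp))).trans hd
  have h2 := WithBot.coe_le_coe.1 h1
  obtain ⟨rs, ⟨hrs, hreg, hlen⟩ | rfl⟩ := exists_list_of_le_depthIn h2
  swap
  · exact ⟨0, by simp, by simp⟩
  have key : ∀ i : ℕ, ∃ a : R, ∀ h : i < rs.length, a ∈ p ∧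
      ∃ u : Localization p.primeCompl, IsUnit u ∧ u * rs[i] = algebraMap R _ a := by
    intro i
    by_cases hi : i < rs.length
    · obtain ⟨a, s, hs⟩ := IsLocalization.exists_mk'_eq p.primeCompl (rs[i])
      have hmem := hrs _ (List.getElem_mem hi)
      refine ⟨a, fun _ => ⟨?_, algebraMap R _ s, IsLocalization.map_units _ s, ?_⟩⟩
      · rw [← hs, IsLocalization.mk'_mem_map_algebraMap_iff] at hmem
        obtain ⟨t, ht, hta⟩ := hmem
        exact (‹p.IsPrime›.mem_or_mem hta).resolve_left ht
      · rw [← hs, mul_comm, IsLocalization.mk'_spec]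
    · exact ⟨0, fun h => (hi h).elim⟩
  choose a ha using key
  refine ⟨a, fun i hi => (ha i (by omega)).1, fun i hi z hz => ?_⟩
  have hi' : i < rs.length := by omega
  have hspan : Ideal.ofList (rs.take i) = (Ideal.span (a '' {j | j < i})).map
      (algebraMap R (Localization p.primeCompl)) := by
    rw [Ideal.map_span]
    refine le_antisymm (Ideal.span_le.2 ?_) (Ideal.span_le.2 ?_)
    · intro x hx
      obtain ⟨j, hj, rfl⟩ := List.mem_take_iff_getElem.1 hx
      obtain ⟨u, hu, hua⟩ := (ha j (by omega)).2
      refine (Ideal.unit_mul_mem_iff_mem _ hu).1 ?_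
      rw [hua]
      exact Ideal.subset_span ⟨_, ⟨j, by simp; omega, rfl⟩, rfl⟩
    · rintro _ ⟨_, ⟨j, hj, rfl⟩, rfl⟩
      have hj' : j < i := hj
      obtain ⟨u, hu, hua⟩ := (ha j (by omega)).2
      rw [← hua]
      refine Ideal.mul_mem_left _ _ (Ideal.subset_span ?_)
      exact List.mem_take_iff_getElem.2 ⟨j, by omega, rfl⟩
  have hsup : Ideal.ofList (rs.take i) ⊔ J.map (algebraMap R (Localization p.primeCompl)) =
      (J ⊔ Ideal.span (a '' {j | j < i})).map (algebraMap R (Localization p.primeCompl)) := by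
    rw [hspan, Ideal.map_sup, sup_comm]
  have hr := hreg.toIsWeaklyRegular.regular_mod_prev i hi'
  rw [isSMulRegular_quotient_iff_mem_of_smul_mem] at hr
  have := hr (algebraMap R _ z • cyclicGen J p) (by
    rw [smul_smul, smul_cyclicGen_mem_iff, hsup]
    obtain ⟨u, hu, hua⟩ := (ha i hi').2
    refine (Ideal.unit_mul_mem_iff_mem _ hu).1 ?_
    rw [← mul_assoc, hua, ← map_mul]
    exact Ideal.mem_map_of_mem _ hz)
  rw [smul_cyclicGen_mem_iff, hsup,
    IsLocalization.algebraMap_mem_map_algebraMap_iff p.primeCompl] at this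
  exact this

end Extract

/-! ### Local regularity -/

section LocReg

variable {R : Type*} [CommRing R] {p N : Ideal R} {a b : R}

lemma LocReg.pow [p.IsPrime] (h : LocReg p N a) (m : ℕ) : LocReg p N (a ^ m) := by
  induction m with
  | zero => exact fun z hz => ⟨1, p.primeCompl.one_mem, by simpa using hz⟩
  | succ m ih =>
    intro z hz
    obtain ⟨s, hs, hsz⟩ := h (a ^ m * z) (by convert hz using 1; ring)
    obtain ⟨s', hs', hsz'⟩ := ih (s * z) (by convert hsz using 1; ring)
    exact ⟨s' * s, p.primeCompl.mul_mem hs' hs, by rwa [mul_assoc]⟩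

lemma LocReg.mul_left [p.IsPrime] (h : LocReg p N a) {s : R} (hs : s ∉ p) :
    LocReg p N (s * a) := by
  intro z hz
  obtain ⟨s', hs', h'⟩ := h (s * z) (by convert hz using 1; ring)
  exact ⟨s' * s, p.primeCompl.mul_mem hs' hs, by rwa [mul_assoc]⟩

lemma mem_sup_span_singleton {I : Ideal R} {x y : R} :
    x ∈ I ⊔ Ideal.span {y} ↔ ∃ w, x - y * w ∈ I := by
  rw [sup_comm, Ideal.mem_span_singleton_sup]
  constructor
  · rintro ⟨w, j, hj, rfl⟩
    exact ⟨w, by convert hj using 1; ring⟩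
  · rintro ⟨w, hw⟩
    exact ⟨w, _, hw, by ring⟩

lemma LocReg.sup_span_pow [p.IsPrime] (ha : LocReg p N a) (hb : LocReg p (N ⊔ Ideal.span {a}) b)
    (m : ℕ) : LocReg p (N ⊔ Ideal.span {a ^ m}) b := by
  induction m with
  | zero => exact fun z _ => ⟨1, p.primeCompl.one_mem, mem_sup_span_singleton.2 ⟨z, by simp⟩⟩
  | succ m ih =>
    intro z hz
    obtain ⟨v, hv⟩ := mem_sup_span_singleton.1 hz
    obtain ⟨s, hs, hsz⟩ := hb z
      (mem_sup_span_singleton.2 ⟨a ^ m * v, by convert hv using 1; ring⟩)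
    obtain ⟨w, hw⟩ := mem_sup_span_singleton.1 hsz
    obtain ⟨s', hs', hsz'⟩ := ha (b * w - a ^ m * (s * v)) (by
      convert sub_mem (N.mul_mem_left s hv) (N.mul_mem_left b hw) using 1; ring)
    obtain ⟨s'', hs'', hsz''⟩ := ih (s' * w)
      (mem_sup_span_singleton.2 ⟨s' * s * v, by convert hsz' using 1; ring⟩)
    obtain ⟨x, hx⟩ := mem_sup_span_singleton.1 hsz''
    refine ⟨s'' * s' * s, p.primeCompl.mul_mem (p.primeCompl.mul_mem hs'' hs') hs,
      mem_sup_span_singleton.2 ⟨x, ?_⟩⟩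
    convert add_mem (N.mul_mem_left (s'' * s') hw) (N.mul_mem_left a hx) using 1
    ring

lemma LocReg.sup_span_mul [p.IsPrime] (hb : LocReg p (N ⊔ Ideal.span {a}) b) {s : R} (hs : s ∉ p) :
    LocReg p (N ⊔ Ideal.span {s * a}) b := by
  intro z hz
  obtain ⟨v, hv⟩ := mem_sup_span_singleton.1 hz
  obtain ⟨s', hs', h⟩ := hb z (mem_sup_span_singleton.2 ⟨s * v, by convert hv using 1; ring⟩)
  obtain ⟨w, hw⟩ := mem_sup_span_singleton.1 h
  refine ⟨s * s', p.primeCompl.mul_mem hs hs', mem_sup_span_singleton.2 ⟨w, ?_⟩⟩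
  convert N.mul_mem_left s hw using 1
  ring

lemma exists_forall_mul_mem [p.IsPrime] {Q : Ideal R} (hQ : Q.FG) {f : R}
    (h : ∀ x ∈ Q, ∃ s ∉ p, s * (f * x) ∈ N) : ∃ s ∉ p, ∀ x ∈ Q, s * (f * x) ∈ N := by
  obtain ⟨T, rfl⟩ := hQ
  choose! s hs h using h
  refine ⟨∏ x ∈ T, s x, p.primeCompl.prod_mem fun x hx => hs x (Ideal.subset_span hx),
    fun x hx => ?_⟩
  induction hx using Submodule.span_induction with
  | mem x hx =>
    obtain ⟨c, hc⟩ := Finset.dvd_prod_of_mem s hx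
    rw [hc]
    convert N.mul_mem_left c (h x (Ideal.subset_span hx)) using 1
    ring
  | zero => simp
  | add x y _ _ hx hy => rw [mul_add, mul_add]; exact add_mem hx hy
  | smul c x _ hx => convert N.mul_mem_left c hx using 1; rw [smul_eq_mul]; ring

lemma exists_mul_pow_mem [p.IsPrime] {I : Ideal R}
    (h : ∀ Q : Ideal R, Q.IsPrime → I ≤ Q → Q ≤ p → a ∈ Q) :
    ∃ s ∉ p, ∃ m : ℕ, s * a ^ m ∈ I := by
  by_contra! hc
  obtain ⟨Q, hQ, hIQ, hdis⟩ := I.exists_le_prime_disjoint (p.primeCompl ⊔ Submonoid.powers a) <| by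
    rw [Set.disjoint_left]
    intro x hx hx'
    obtain ⟨s, hs, _, ⟨m, rfl⟩, rfl⟩ := Submonoid.mem_sup.1 hx'
    exact hc s hs m hx
  rw [Set.disjoint_left] at hdis
  refine hdis (h Q hQ hIQ fun x hx => ?_)
    (Submonoid.mem_sup_right (Submonoid.mem_powers a))
  by_contra hxp
  exact hdis hx (Submonoid.mem_sup_left hxp)

/-- A local form of Hartshorne's connectedness lemma. -/
lemma not_sup_le_of_locReg [p.IsPrime] {J K L : Ideal R} (hK : K.FG) (hL : L.FG)
    (hKL : ∀ x ∈ K, ∀ y ∈ L, x * y ∈ J) (hmemK : ∀ f, (∀ y ∈ L, f * y ∈ J) → f ∈ K)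
    (hmemL : ∀ f, (∀ x ∈ K, f * x ∈ J) → f ∈ L)
    (ha : a ∈ K ⊔ L) (hb : b ∈ K ⊔ L) (hra : LocReg p J a)
    (hrb : LocReg p (J ⊔ Ideal.span {a}) b) : ¬ K ⊔ L ≤ p := by
  intro hp
  obtain ⟨x, hx, y, hy, rfl⟩ := Submodule.mem_sup.1 ha
  obtain ⟨x', hx', y', hy', rfl⟩ := Submodule.mem_sup.1 hb
  obtain ⟨s, hs, hsx⟩ := hrb x (mem_sup_span_singleton.2 ⟨x', by
    convert sub_mem (hKL x hx y' hy') (hKL x' hx' y hy) using 1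
    ring⟩)
  obtain ⟨f, hf⟩ := mem_sup_span_singleton.1 hsx
  obtain ⟨s₁, hs₁, h₁⟩ := exists_forall_mul_mem hL (f := f) (N := J) (p := p) fun z hz =>
    hra _ (by
      convert sub_mem (J.mul_mem_left s (hKL x hx z hz)) (J.mul_mem_left z hf) using 1
      ring)
  obtain ⟨s₂, hs₂, h₂⟩ := exists_forall_mul_mem hK (f := s - f) (N := J) (p := p) fun z hz =>
    hra _ (by
      convert add_mem (J.mul_mem_left s (hKL z hz y hy)) (J.mul_mem_left z hf) using 1
      ring)
  have h₁' : s₁ * f ∈ K := hmemK _ fun z hz => by rw [mul_assoc]; exact h₁ z hz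
  have h₂' : s₂ * (s - f) ∈ L := hmemL _ fun z hz => by rw [mul_assoc]; exact h₂ z hz
  have hmem : s₁ * s₂ * s ∈ K ⊔ L := by
    convert add_mem (Ideal.mem_sup_left (K.mul_mem_left s₂ h₁'))
      (Ideal.mem_sup_right (L.mul_mem_left s₁ h₂')) using 1
    ring
  exact p.primeCompl.mul_mem (p.primeCompl.mul_mem hs₁ hs₂) hs (hp hmem)

end LocReg

/-! ### The last step of a sequentially Serre filtration -/

section TopStep

variable {k : Type*} [Field k] {V : Type*} {Δ : Set (Finset V)} {d : ℕ}

/-- The ideal of the subcomplex generated by the faces with `d` elements. -/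
noncomputable def topIdeal (k : Type*) [Field k] {V : Type*} (Δ : Set (Finset V)) (d : ℕ) :
    Ideal (MvPolynomial V k) :=
  ⨅ F ∈ {F | F ∈ Δ ∧ F.card = d}, facePrime k F

lemma mem_topIdeal {f : MvPolynomial V k} :
    f ∈ topIdeal k Δ d ↔ ∀ F ∈ Δ, F.card = d → f ∈ facePrime k F := by
  simp [topIdeal]

lemma isHomogeneousIdeal_topIdeal : IsHomogeneousIdeal k (topIdeal k Δ d) := by
  intro f hf i
  rw [mem_topIdeal] at hf ⊢
  exact fun F hF hFd => isHomogeneousIdeal_facePrime F f (hf F hF hFd) i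

lemma mul_mem_subquot_annihilator {R : Type*} [CommRing R] {J J' : Ideal R} {l x : R}
    (hl : l ∈ Module.annihilator R (subquot J J')) (hx : x ∈ J') : l * x ∈ J := by
  have := Module.mem_annihilator.1 hl (Submodule.Quotient.mk ⟨x, hx⟩)
  rw [← Submodule.Quotient.mk_smul, Submodule.Quotient.mk_eq_zero] at this
  simpa using this

lemma ringKrullDim_quotient_anti {R : Type*} [CommRing R] {I J : Ideal R} (h : I ≤ J) :
    ringKrullDim (R ⧸ J) ≤ ringKrullDim (R ⧸ I) :=
  ringKrullDim_le_of_surjective (Ideal.Quotient.factor h) (Ideal.Quotient.factor_surjective h)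

lemma le_facePrime_of_filtration [Finite V] (hΔ : IsComplex Δ) (hd : ∀ F ∈ Δ, F.card ≤ d)
    {F : Finset V} (hF : F ∈ Δ) (hFd : F.card = d)
    {t : ℕ} {J : ℕ → Ideal (MvPolynomial V k)} (h0 : J 0 = srIdeal k Δ)
    (hlt : ∀ i < t + 1, J i < J (i + 1))
    (hdim : ∀ i : ℕ, i + 2 ≤ t + 1 →
      mDim (MvPolynomial V k) (subquot (J i) (J (i + 1))) <
        mDim (MvPolynomial V k) (subquot (J (i + 1)) (J (i + 2)))) :
    J t ≤ facePrime k F := by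
  have hmono : ∀ i ≤ t, srIdeal k Δ ≤ J i := by
    intro i hi
    induction i with
    | zero => exact h0.ge
    | succ i ih => exact (ih (by omega)).trans (hlt i (by omega)).le
  have hlast : mDim (MvPolynomial V k) (subquot (J t) (J (t + 1))) ≤ d := by
    refine le_trans (ringKrullDim_quotient_anti ?_) (ringKrullDim_quotient_srIdeal_le hd)
    intro x hx
    rw [Module.mem_annihilator]
    intro m
    obtain ⟨y, rfl⟩ := Submodule.Quotient.mk_surjective _ m
    rw [← Submodule.Quotient.mk_smul, Submodule.Quotient.mk_eq_zero]
    exact (J t).mul_mem_right _ (hmono t le_rfl hx)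
  have hsmall : ∀ i j, i < j → j ≤ t →
      mDim (MvPolynomial V k) (subquot (J i) (J (i + 1))) <
        mDim (MvPolynomial V k) (subquot (J j) (J (j + 1))) := by
    intro i j hij
    induction j, hij using Nat.le_induction with
    | base => exact fun h => hdim i (by omega)
    | succ j hj ih => exact fun h => (ih (by omega)).trans (hdim j (by omega))
  have key : ∀ i ≤ t, ∃ l ∉ facePrime k F, ∀ x ∈ J i, l * x ∈ srIdeal k Δ := by
    intro i hi
    induction i with
    | zero =>
      refine ⟨1, (facePrime k F).primeCompl.one_mem, fun x hx => ?_⟩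
      rwa [one_mul, ← h0]
    | succ i ih =>
      obtain ⟨l, hl, hlx⟩ := ih (by omega)
      have hnot : ¬ Module.annihilator (MvPolynomial V k) (subquot (J i) (J (i + 1))) ≤
          facePrime k F := by
        intro hle
        have h1 := ringKrullDim_quotient_anti hle
        rw [ringKrullDim_quotient_facePrime, hFd] at h1
        exact absurd (h1.trans_lt (hsmall i t (by omega) le_rfl)) hlast.not_gt
      obtain ⟨l', hl', hl'F⟩ := Set.not_subset.1 hnot
      refine ⟨l * l', (facePrime k F).primeCompl.mul_mem hl hl'F, fun x hx => ?_⟩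
      rw [mul_assoc]
      exact hlx _ (mul_mem_subquot_annihilator hl' hx)
  obtain ⟨l, hl, hlx⟩ := key t le_rfl
  intro x hx
  exact (Ideal.IsPrime.mem_or_mem inferInstance
    (srIdeal_le_facePrime hΔ hF (hlx x hx))).resolve_left hl

/-- If an annihilator of `K` modulo `J` has a nonzero constant term, then `K ≤ J`. -/
lemma le_of_mul_mem_of_constantCoeff_ne_zero {J K : Ideal (MvPolynomial V k)}
    (hJ : IsHomogeneousIdeal k J) (hK : IsHomogeneousIdeal k K) {l : MvPolynomial V k}
    (hl : constantCoeff l ≠ 0) (h : ∀ x ∈ K, l * x ∈ J) : K ≤ J := by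
  intro x hx
  rw [← sum_homogeneousComponent x]
  refine sum_mem fun i _ => ?_
  have h1 := hJ _ (h _ (hK x hx i)) i
  rw [mul_comm] at h1
  have h2 : homogeneousComponent i (homogeneousComponent i x * l) =
      C (constantCoeff l) * homogeneousComponent i x := by
    conv_lhs => rw [← sum_homogeneousComponent l, Finset.mul_sum, map_sum]
    rw [Finset.sum_eq_single 0]
    · rw [homogeneousComponent_zero, constantCoeff_eq, mul_comm, homogeneousComponent_C_mul,
        homogeneousComponent_eq_self (homogeneousComponent_isHomogeneous i x)]
    · intro j _ hj
      rw [homogeneousComponent_of_mem ((homogeneousComponent_isHomogeneous i x).mul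
        (homogeneousComponent_isHomogeneous j l)), if_neg (by omega)]
    · simp
  rw [h2] at h1
  have := J.mul_mem_left (C (constantCoeff l)⁻¹) h1
  rwa [← mul_assoc, ← C_mul, inv_mul_cancel₀ hl, C_1, one_mul] at this

/-- If nothing lies strictly between a top-dimensional face prime and `p`, then `p` is minimal
over every ideal that contains `srIdeal k Δ` and all the top-dimensional face monomials. -/
lemma le_of_no_intermediate [Finite V] {F : Finset V} (hF : F ∈ Δ) (hFd : F.card = d)
    (hΔd : ∀ F ∈ Δ, F.card ≤ d) {L p Q : Ideal (MvPolynomial V k)} [p.IsPrime] [Q.IsPrime]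
    (hIL : srIdeal k Δ ≤ L) (hmon : ∀ F ∈ Δ, F.card = d → ∏ i ∈ F, X i ∈ L)
    (hFp : facePrime k F ≤ p)
    (hno : ∀ P : Ideal (MvPolynomial V k), P.IsPrime → facePrime k F < P → P ≤ p → p ≤ P)
    (hLQ : L ≤ Q) (hQp : Q ≤ p) : p ≤ Q := by
  classical
  obtain ⟨j, hj, hjQ⟩ := prod_X_mem_iff.1 (hLQ (hmon F hF hFd))
  have hp : p ≤ facePrime k (F.erase j) := by
    refine hno _ inferInstance (facePrime_erase_lt hj) ?_
    rw [facePrime_erase]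
    exact sup_le hFp ((Ideal.span_singleton_le_iff_mem _).2 (hQp hjQ))
  obtain ⟨G, hG, hGQ⟩ := exists_face_of_srIdeal_le (hIL.trans hLQ)
  have hsub : F.erase j ⊆ G := fun i hi => (hGQ i).2 fun h =>
    X_mem_facePrime.1 (hp (hQp h)) hi
  refine hp.trans (facePrime_le_iff.2 fun i hi => ?_)
  by_contra hiQ
  have hcard : G.card = d := by
    refine le_antisymm (hΔd G hG) ?_
    have h1 := Finset.card_le_card (Finset.insert_subset ((hGQ i).2 hiQ) hsub)
    rw [Finset.card_insert_of_notMem hi, Finset.card_erase_of_mem hj] at h1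
    omega
  obtain ⟨l, hl, hlQ⟩ := prod_X_mem_iff.1 (hLQ (hmon G hG hcard))
  exact (hGQ l).1 hl hlQ

lemma topIdeal_le_of_isSerreMod [Finite V] (hd : HasDim Δ d)
    {J : Ideal (MvPolynomial V k)} (hJ : IsHomogeneousIdeal k J) (hIJ : srIdeal k Δ ≤ J)
    (hJK : J ≤ topIdeal k Δ d) {r : ℕ} (hr : 2 ≤ r)
    (hS : IsSerreMod r (MvPolynomial V k) (subquot J ⊤)) : topIdeal k Δ d ≤ J := by
  set K := topIdeal k Δ d with hKdef
  by_contra hKJ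
  set L : Ideal (MvPolynomial V k) := J.colon K with hL
  have hmemL : ∀ l, l ∈ L ↔ ∀ x ∈ K, l * x ∈ J := fun l => by
    rw [hL, Submodule.mem_colon]; rfl
  have hJL : J ≤ L := fun x hx => (hmemL x).2 fun y _ => J.mul_mem_right y hx
  have hmon : ∀ F ∈ Δ, F.card = d → ∏ i ∈ F, X i ∈ L := fun F hF hFd =>
    (hmemL _).2 fun x hx => hIJ <|
      prod_X_mul_mem_srIdeal (fun G hG => hFd ▸ hd.1 G hG) (mem_topIdeal.1 hx F hF hFd)
  obtain ⟨F₀, hF₀, hF₀d⟩ := hd.2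
  have hL0 : L ≤ facePrime k (∅ : Finset V) := fun l hl => mem_facePrime_empty.2 <| by
    by_contra hl0
    exact hKJ (le_of_mul_mem_of_constantCoeff_ne_zero hJ isHomogeneousIdeal_topIdeal hl0
      ((hmemL l).1 hl))
  have hK0 : K ≤ facePrime k (∅ : Finset V) := fun x hx =>
    facePrime_anti (Finset.empty_subset F₀) (mem_topIdeal.1 hx F₀ hF₀ hF₀d)
  obtain ⟨p, hpmin, -⟩ := Ideal.exists_minimalPrimes_le (sup_le hK0 hL0)
  have hp : p.IsPrime := hpmin.isPrime
  have hKLp : K ⊔ L ≤ p := hpmin.le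
  have hpow : ∀ x ∈ p, ∃ s ∉ p, ∃ m : ℕ, s * x ^ m ∈ K ⊔ L := fun x hx =>
    exists_mul_pow_mem fun Q hQ hle hQp => hpmin.2 ⟨hQ, hle⟩ hQp hx
  obtain ⟨F, hF, hFd, hFp⟩ : ∃ F ∈ Δ, F.card = d ∧ facePrime k F ≤ p := by
    have h : (Set.toFinite {F | F ∈ Δ ∧ F.card = d}).toFinset.inf (facePrime k) ≤ p := by
      rw [Finset.inf_eq_iInf]
      have h : K ≤ p := le_sup_left.trans hKLp
      simpa [hKdef, topIdeal] using h
    obtain ⟨F, hF, hle⟩ := (Ideal.IsPrime.inf_le' hp).1 h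
    rw [Set.Finite.mem_toFinset] at hF
    exact ⟨F, hF.1, hF.2, hle⟩
  have hlt : facePrime k F < p := lt_of_le_of_ne hFp fun h =>
    prod_X_notMem_facePrime (k := k) F (h ▸ hKLp (Ideal.mem_sup_right (hmon F hF hFd)))
  by_cases hno : ∀ P : Ideal (MvPolynomial V k), P.IsPrime → facePrime k F < P → P ≤ p → p ≤ P
  · let c : LTSeries (PrimeSpectrum (MvPolynomial V k)) :=
      { length := 1
        toFun := ![⟨facePrime k F, inferInstance⟩, ⟨p, hp⟩]
        step := fun i => by fin_cases i; exact hlt }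
    obtain ⟨a, ha, hra⟩ := hS.exists_locReg p c
      (fun x hx => mem_topIdeal.1 (hJK hx) F hF hFd) le_rfl (by omega : 1 ≤ r) le_rfl
    have hr0 : LocReg p J (a 0) := by simpa using hra 0 one_pos
    obtain ⟨s, hs, m, hsm⟩ := exists_mul_pow_mem (p := p) (a := a 0) (I := L)
      fun Q hQ hLQ hQp => le_of_no_intermediate hF hFd hd.1 (hIJ.trans hJL) hmon hFp hno hLQ hQp
        (ha 0 one_pos)
    obtain ⟨s', hs', h'⟩ := exists_forall_mul_mem (p := p) (f := 1) (N := J)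
      (IsNoetherian.noetherian K) fun x hx => by
        rw [one_mul]
        exact ((hr0.pow m).mul_left hs) x ((hmemL _).1 hsm x hx)
    exact hs' (hKLp (Ideal.mem_sup_right ((hmemL s').2 fun x hx => by simpa using h' x hx)))
  · push Not at hno
    obtain ⟨P, hP, hFP, hPp, hpP⟩ := hno
    let c : LTSeries (PrimeSpectrum (MvPolynomial V k)) :=
      { length := 2
        toFun := ![⟨facePrime k F, inferInstance⟩, ⟨P, hP⟩, ⟨p, hp⟩]
        step := fun i => by
          fin_cases i
          · exact hFP
          · exact lt_of_le_not_ge hPp hpP }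
    obtain ⟨a, ha, hra⟩ := hS.exists_locReg p c
      (fun x hx => mem_topIdeal.1 (hJK hx) F hF hFd) le_rfl hr le_rfl
    have hr0 : LocReg p J (a 0) := by simpa using hra 0 two_pos
    have hr1 : LocReg p (J ⊔ Ideal.span {a 0}) (a 1) := by
      have := hra 1 one_lt_two
      have h1 : {j : ℕ | j < 1} = {0} := by ext; simp
      rwa [h1, Set.image_singleton] at this
    obtain ⟨s, hs, m, hsm⟩ := hpow (a 0) (ha 0 two_pos)
    obtain ⟨s', hs', m', hsm'⟩ := hpow (a 1) (ha 1 one_lt_two)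
    refine not_sup_le_of_locReg (IsNoetherian.noetherian K) (IsNoetherian.noetherian L)
      (fun x hx y hy => by rw [mul_comm]; exact (hmemL y).1 hy x hx) ?_
      (fun f hf => (hmemL f).2 hf) hsm hsm' ((hr0.pow m).mul_left hs)
      ((((hr0.sup_span_pow hr1 m).sup_span_mul hs).pow m').mul_left hs') hKLp
    intro f hf
    refine mem_topIdeal.2 fun G hG hGd => ?_
    exact (Ideal.IsPrime.mem_or_mem inferInstance (mem_topIdeal.1 (hJK (hf _ (hmon G hG hGd)))
      G hG hGd)).resolve_right (prod_X_notMem_facePrime G)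

/-- If `Δ` is sequentially `S_r` with `r ≥ 2`, then the subcomplex generated by the faces of
maximal dimension satisfies `S_r`. -/
theorem IsSeqSerre.topIdeal [Finite V] (hΔ : IsComplex Δ) (hd : HasDim Δ d) {r : ℕ} (hr : 2 ≤ r)
    (h : IsSeqSerre k Δ r) :
    IsSerreMod r (MvPolynomial V k) (subquot (topIdeal k Δ d) ⊤) := by
  obtain ⟨t, J, h0, ht, hhom, hlt, hS, hdim⟩ := h
  obtain ⟨F, hF, hFd⟩ := hd.2
  cases t with
  | zero =>
    have := srIdeal_le_facePrime (k := k) hΔ hF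
    rw [← h0, ht, top_le_iff] at this
    exact absurd this (facePrime_isPrime F).ne_top
  | succ t =>
    have hmono : ∀ i ≤ t, srIdeal k Δ ≤ J i := by
      intro i hi
      induction i with
      | zero => exact h0.ge
      | succ i ih => exact (ih (by omega)).trans (hlt i (by omega)).le
    have hle : J t ≤ SeqSr.topIdeal k Δ d := fun x hx => mem_topIdeal.2 fun G hG hGd =>
      le_facePrime_of_filtration hΔ hd.1 hG hGd h0 hlt hdim hx
    have hSt := hS t (by omega)
    rw [ht] at hSt
    rwa [le_antisymm (topIdeal_le_of_isSerreMod hd (hhom t (by omega)) (hmono t le_rfl) hle hr hSt)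
      hle]

end TopStep

/-! ### An obstruction to depth three from a cycle of components -/

section Cycle

variable {R : Type*} [CommRing R]

lemma false_of_locReg_cycle {ι : Type*} [Finite ι] (σ : ι → ι) (e : ι → R) (P Q : ι → Ideal R)
    (p J : Ideal R) [p.IsPrime] (hP : ∀ i, (P i).IsPrime) (hQ : ∀ i, (Q i).IsPrime)
    (hPp : ∀ i, P i ≤ p) (hQp : ∀ i, Q i ≤ p) (hPQ : ∀ i, P i ≤ Q i) (hPQ' : ∀ i, P (σ i) ≤ Q i)
    (hJ : ∀ x, x ∈ J ↔ ∀ i, x ∈ P i)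
    (hglue : ∀ f : ι → R, (∀ i, f (σ i) - f i ∈ Q i) → ∃ g, ∀ i, g - f i ∈ P i)
    (hbound : ∀ y ∈ p, ∃ τ : ι → R, ∀ i, τ (σ i) - τ i - y * e i ∈ Q i)
    (hnot : ∀ s ∉ p, ∀ τ : ι → R, ∃ i, τ (σ i) - τ i - s * e i ∉ Q i)
    (hQlt : ∀ i, ∃ y ∈ p, y ∉ Q i)
    (hpair : ∀ i, ∃ u ∈ p, ∃ v ∈ p, u ∉ P i ∧ v ∉ P i ⊔ Ideal.span {u} ∧
      P i ⊔ Ideal.span {u} ≤ p ∧ (P i ⊔ Ideal.span {u}).IsPrime)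
    (hsep : ∀ i, ∃ x ∉ P i, ∀ j ≠ i, x ∈ P j)
    {a b c : R} (ha : a ∈ p) (hb : b ∈ p) (hc : c ∈ p) (hra : LocReg p J a)
    (hrb : LocReg p (J ⊔ Ideal.span {a}) b) (hrc : LocReg p (J ⊔ Ideal.span {a, b}) c) : False := by
  have haP : ∀ i, a ∉ P i := by
    intro i hi
    obtain ⟨x, hx, hxj⟩ := hsep i
    obtain ⟨s, hs, hsx⟩ := hra x ((hJ _).2 fun j => by
      by_cases hj : j = i
      · subst hj; exact (P j).mul_mem_right _ hi
      · exact (P j).mul_mem_left _ (hxj j hj))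
    exact ((hP i).mem_or_mem ((hJ _).1 hsx i)).elim (fun h => hs (hPp i h)) hx
  obtain ⟨α, hα⟩ := hbound a ha
  obtain ⟨β, hβ⟩ := hbound b hb
  obtain ⟨γ, hγ⟩ := hbound c hc
  obtain ⟨g₁, hg₁⟩ := hglue (fun i => b * α i - a * β i) fun i => by
    convert sub_mem ((Q i).mul_mem_left b (hα i)) ((Q i).mul_mem_left a (hβ i)) using 1; ring
  obtain ⟨g₂, hg₂⟩ := hglue (fun i => c * α i - a * γ i) fun i => by
    convert sub_mem ((Q i).mul_mem_left c (hα i)) ((Q i).mul_mem_left a (hγ i)) using 1; ring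
  obtain ⟨g₃, hg₃⟩ := hglue (fun i => c * β i - b * γ i) fun i => by
    convert sub_mem ((Q i).mul_mem_left c (hβ i)) ((Q i).mul_mem_left b (hγ i)) using 1; ring
  have hmem : ∀ x, x ∈ J ⊔ Ideal.span {a, b} ↔ ∃ u v, x - a * u - b * v ∈ J := by
    intro x
    rw [Ideal.span_insert, ← sup_assoc, mem_sup_span_singleton]
    simp only [mem_sup_span_singleton]
    constructor
    · rintro ⟨v, u, h⟩
      exact ⟨u, v, by rwa [sub_right_comm]⟩
    · rintro ⟨u, v, h⟩
      exact ⟨v, u, by rwa [sub_right_comm]⟩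
  obtain ⟨s, hs, hsg⟩ := hrc g₁ ((hmem _).2 ⟨-g₃, g₂, (hJ _).2 fun i => by
    convert add_mem (sub_mem ((P i).mul_mem_left c (hg₁ i)) ((P i).mul_mem_left b (hg₂ i)))
      ((P i).mul_mem_left a (hg₃ i)) using 1
    ring⟩)
  obtain ⟨u, v, huv⟩ := (hmem _).1 hsg
  rw [hJ] at huv
  set t : ι → R := fun i => s * α i - v with ht
  have htr : ∀ i, b * t i - a * (s * β i + u) ∈ P i := fun i => by
    convert sub_mem (huv i) ((P i).mul_mem_left s (hg₁ i)) using 1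
    ring
  have key : ∀ y ∈ p, ∃ s' ∉ p, ∃ w : ι → R, ∀ i, s' * y * t i - a * w i ∈ P i ∧
      w (σ i) - w i - s' * s * y * e i ∈ Q i := by
    intro y hy
    obtain ⟨τ, hτ⟩ := hbound y hy
    obtain ⟨g, hg⟩ := hglue (fun i => y * t i - a * s * τ i) fun i => by
      convert sub_mem ((Q i).mul_mem_left (y * s) (hα i)) ((Q i).mul_mem_left (a * s) (hτ i)) using 1
      ring
    obtain ⟨h, hh⟩ := hglue (fun i => y * (s * β i + u) - b * s * τ i) fun i => by
      convert sub_mem ((Q i).mul_mem_left (y * s) (hβ i)) ((Q i).mul_mem_left (b * s) (hτ i)) using 1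
      ring
    obtain ⟨s', hs', hg'⟩ := hrb g (mem_sup_span_singleton.2 ⟨h, (hJ _).2 fun i => by
      convert add_mem (sub_mem ((P i).mul_mem_left b (hg i)) ((P i).mul_mem_left a (hh i)))
        ((P i).mul_mem_left y (htr i)) using 1
      ring⟩)
    obtain ⟨a', ha'⟩ := mem_sup_span_singleton.1 hg'
    rw [hJ] at ha'
    refine ⟨s', hs', fun i => s' * s * τ i + a', fun i => ⟨?_, ?_⟩⟩
    · convert sub_mem (ha' i) ((P i).mul_mem_left s' (hg i)) using 1
      ring
    · convert (Q i).mul_mem_left (s' * s) (hτ i) using 1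
      ring
  have hdiv : ∀ i, ∃ s' ∉ p, ∃ w, s' * t i - a * w ∈ P i := by
    intro i
    obtain ⟨x, hx, y, hy, hxP, hyP, hle, hprime⟩ := hpair i
    obtain ⟨sx, hsx, w, hw⟩ := key x hx
    obtain ⟨sy, hsy, w', hw'⟩ := key y hy
    have h1 : sy * y * w i - sx * x * w' i ∈ P i := by
      refine ((hP i).mem_or_mem (x := a) ?_).resolve_left (haP i)
      convert sub_mem ((P i).mul_mem_left (sx * x) (hw' i).1)
        ((P i).mul_mem_left (sy * y) (hw i).1) using 1
      ring
    have h2 : sy * y * w i ∈ P i ⊔ Ideal.span {x} :=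
      mem_sup_span_singleton.2 ⟨sx * w' i, by convert h1 using 1; ring⟩
    have h3 := (hprime.mem_or_mem h2).resolve_left fun h =>
      (hprime.mem_or_mem h).elim (fun h => hsy (hle h)) hyP
    obtain ⟨z, hz⟩ := mem_sup_span_singleton.1 h3
    refine ⟨sx, hsx, z, ((hP i).mem_or_mem (x := x) ?_).resolve_left hxP⟩
    convert add_mem (hw i).1 ((P i).mul_mem_left a hz) using 1
    ring
  choose s₀ hs₀ τ₀ hτ₀ using hdiv
  have := Fintype.ofFinite ι
  obtain ⟨s', hs', τ, hτ⟩ : ∃ s' ∉ p, ∃ τ : ι → R, ∀ i, s' * t i - a * τ i ∈ P i := by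
    have hd : ∀ i, ∃ z, ∏ j, s₀ j = s₀ i * z := fun i =>
      Finset.dvd_prod_of_mem s₀ (Finset.mem_univ i)
    choose z hz using hd
    refine ⟨∏ j, s₀ j, p.primeCompl.prod_mem fun j _ => hs₀ j, fun i => z i * τ₀ i, fun i => ?_⟩
    rw [hz i]
    convert (P i).mul_mem_left (z i) (hτ₀ i) using 1
    ring
  obtain ⟨i, hi⟩ := hnot (s' * s) (p.primeCompl.mul_mem hs' hs) τ
  obtain ⟨y, hy, hyQ⟩ := hQlt i
  obtain ⟨sy, hsy, w, hw⟩ := key y hy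
  have hwτ : ∀ j, s' * w j - sy * y * τ j ∈ P j := by
    intro j
    refine ((hP j).mem_or_mem (x := a) ?_).resolve_left (haP j)
    convert sub_mem ((P j).mul_mem_left (sy * y) (hτ j)) ((P j).mul_mem_left s' (hw j).1) using 1
    ring
  have hfin : sy * y * (τ (σ i) - τ i - s' * s * e i) ∈ Q i := by
    convert sub_mem ((Q i).mul_mem_left s' (hw i).2)
      (sub_mem (hPQ' i (hwτ (σ i))) (hPQ i (hwτ i))) using 1
    ring
  exact ((hQ i).mem_or_mem hfin).elim
    (fun h => ((hQ i).mem_or_mem h).elim (fun h => hsy (hQp i h)) hyQ) hi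

end Cycle

/-! ### Arcs of an odd cycle -/

section Arc

variable {V : Type*} [Fintype V] {d : ℕ}

lemma val_sub_eq_ite {m : ℕ} (a b : Fin m) :
    (a - b).val = if b.val ≤ a.val then a.val - b.val else m + a.val - b.val := by
  split_ifs with h
  · exact Fin.coe_sub_iff_le.2 h
  · exact Fin.coe_sub_iff_lt.2 (not_le.1 h)

/-- The elements of `V` labelled `i, i + 1, …, i + d - 1` by `h`. -/
def arc (h : V ≃ Fin (2 * d + 1)) (i : Fin (2 * d + 1)) : Finset V :=
  Finset.univ.filter fun v => (h v - i).val < d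

variable {h : V ≃ Fin (2 * d + 1)} {i j : Fin (2 * d + 1)}

lemma mem_arc {v : V} : v ∈ arc h i ↔ (h v - i).val < d := by simp [arc]

lemma card_arc : (arc h i).card = d := by
  have : (arc h i).map (h.trans (Equiv.subRight i)).toEmbedding =
      Finset.univ.filter fun x : Fin (2 * d + 1) => x.val < d := by
    ext x
    simp only [Finset.mem_map_equiv, Finset.mem_filter, Finset.mem_univ, true_and, mem_arc]
    simp
  rw [← Finset.card_map, this, Fin.card_filter_val_lt]
  omega

lemma val_one_of_pos (hd : 0 < d) : (1 : Fin (2 * d + 1)).val = 1 := by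
  rw [Fin.val_one', Nat.mod_eq_of_lt (by omega)]

/-- The arcs containing a given set and meeting in a point are connected to each other by shifts. -/
lemma mem_arc_of_between {v w : V} {a : Fin (2 * d + 1)} (hij : (h v - j).val ≤ (h v - a).val)
    (hia : (h v - a).val ≤ (h v - i).val) (hvi : v ∈ arc h i) (hwi : w ∈ arc h i)
    (hwj : w ∈ arc h j) : w ∈ arc h a := by
  rw [mem_arc] at *
  simp only [val_sub_eq_ite] at *
  have := (h v).isLt
  have := (h w).isLt
  have := i.isLt
  have := j.isLt
  have := a.isLt
  split_ifs at * <;> omega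

lemma eq_of_arc_subset (hd : 0 < d) (hs : arc h i ⊆ arc h j) : i = j := by
  have h1 : h.symm i ∈ arc h i := by simp [mem_arc, hd]
  have h2 : h.symm (i + ⟨d - 1, by omega⟩) ∈ arc h i := by
    simp [mem_arc, hd]
  have h1 := mem_arc.1 (hs h1)
  have h2 := mem_arc.1 (hs h2)
  simp only [val_sub_eq_ite, Fin.val_add_eq_ite, Equiv.apply_symm_apply] at h1 h2
  have := i.isLt
  have := j.isLt
  ext
  split_ifs at * <;> omega

end Arc

section Arc

variable {V : Type*} [Fintype V] {d : ℕ} {h : V ≃ Fin (2 * d + 1)} {i j : Fin (2 * d + 1)}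

lemma val_sub_add_one (hd : 0 < d) {a : Fin (2 * d + 1)} (ha : 0 < (a - i).val) :
    (a - (i + 1)).val = (a - i).val - 1 := by
  rw [val_sub_eq_ite] at *
  rw [val_sub_eq_ite, Fin.val_add_eq_ite, val_one_of_pos hd]
  have := i.isLt
  have := a.isLt
  split_ifs at * <;> omega

lemma val_add_one_eq_ite (hd : 0 < d) (i : Fin (2 * d + 1)) :
    (i + 1).val = if i.val = 2 * d then 0 else i.val + 1 := by
  rw [Fin.val_add_eq_ite, val_one_of_pos hd]
  have := i.isLt
  split_ifs <;> omega

lemma eq_of_forall_add_one {α : Type*} (hd : 0 < d) (S : Finset V) (c : Fin (2 * d + 1) → α)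
    (hc : ∀ i, S ⊆ arc h i → S ⊆ arc h (i + 1) → c (i + 1) = c i) (hi : S ⊆ arc h i)
    (hj : S ⊆ arc h j) : c i = c j := by
  obtain rfl | ⟨v, hv⟩ := S.eq_empty_or_nonempty
  · have key : ∀ l, c l = c 0 := by
      intro l
      induction l using Fin.induction with
      | zero => rfl
      | succ l ih => rw [← Fin.coeSucc_eq_succ, hc _ (by simp) (by simp), ih]
    rw [key, key j]
  · have key : ∀ (n : ℕ) (i j : Fin (2 * d + 1)), (h v - i).val = (h v - j).val + n →
        S ⊆ arc h i → S ⊆ arc h j → c i = c j := by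
      intro n
      induction n with
      | zero =>
        intro i j hn _ _
        rw [sub_right_injective (Fin.ext hn)]
      | succ n ih =>
        intro i j hn hi hj
        have h1 := val_sub_add_one (i := i) (a := h v) hd (by omega)
        have h2 : S ⊆ arc h (i + 1) := fun w hw =>
          mem_arc_of_between (v := v) (i := i) (j := j) (by omega) (by omega) (hi hv) (hi hw)
            (hj hw)
        rw [← hc i hi h2]
        exact ih _ _ (by omega) h2 hj
    obtain hle | hle := le_total (h v - j).val (h v - i).val
    · exact key _ i j (Nat.add_sub_of_le hle).symm hi hj
    · exact (key _ j i (Nat.add_sub_of_le hle).symm hj hi).symm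

variable {k : Type*} [Field k]

lemma exists_sub_mem_facePrime [DecidableEq V] (hd : 0 < d)
    (f : Fin (2 * d + 1) → MvPolynomial V k)
    (hf : ∀ i, f (i + 1) - f i ∈ facePrime k (arc h i ∩ arc h (i + 1))) :
    ∃ g, ∀ i, g - f i ∈ facePrime k (arc h i) := by
  classical
  have hconst : ∀ (m : V →₀ ℕ) i j, m.support ⊆ arc h i → m.support ⊆ arc h j →
      coeff m (f i) = coeff m (f j) := fun m i j hi hj =>
    eq_of_forall_add_one hd m.support (fun l => coeff m (f l)) (fun l h1 h2 => by
      have := mem_facePrime.1 (hf l) m (Finset.subset_inter h1 h2)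
      rwa [coeff_sub, sub_eq_zero] at this) hi hj
  have hidx : ∀ m : V →₀ ℕ, ∃ l, ∀ i, m.support ⊆ arc h i → m.support ⊆ arc h l := fun m => by
    by_cases hm : ∃ i, m.support ⊆ arc h i
    · exact hm.imp fun l hl _ _ => hl
    · exact ⟨0, fun i hi => (hm ⟨i, hi⟩).elim⟩
  choose l hl using hidx
  refine ⟨∑ m ∈ Finset.univ.biUnion fun i => (f i).support, monomial m (coeff m (f (l m))),
    fun i => mem_facePrime.2 fun m hm => ?_⟩
  rw [coeff_sub, sub_eq_zero, coeff_sum, hconst m i (l m) hm (hl m i hm)]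
  simp only [coeff_monomial, Finset.sum_ite_eq']
  split_ifs with h'
  · rfl
  · simp only [Finset.mem_biUnion, Finset.mem_univ, true_and, not_exists, mem_support_iff,
      not_not] at h'
    exact (h' (l m)).symm

lemma exists_boundary [DecidableEq V] (hd : 0 < d) {y : MvPolynomial V k}
    (hy : y ∈ facePrime k (∅ : Finset V)) : ∃ τ : Fin (2 * d + 1) → MvPolynomial V k, ∀ i,
      τ (i + 1) - τ i - y * (if i + 1 = 0 then 1 else 0) ∈
        facePrime k (arc h i ∩ arc h (i + 1)) := by
  rw [facePrime] at hy
  induction hy using Submodule.span_induction with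
  | mem x hx =>
    obtain ⟨v, -, rfl⟩ := hx
    refine ⟨fun i => X v * (if i.val ≤ (h v).val then 1 else 0), fun i => ?_⟩
    rw [← mul_sub, ← mul_sub]
    by_cases hv : v ∈ arc h i ∩ arc h (i + 1)
    · rw [Finset.mem_inter, mem_arc, mem_arc] at hv
      obtain ⟨h1, h2⟩ := hv
      have := i.isLt
      have := (h v).isLt
      rw [val_sub_eq_ite] at h1 h2
      have h3 := val_add_one_eq_ite hd i
      have h4 : i + 1 = 0 ↔ (i + 1).val = 0 := Fin.ext_iff
      rw [h3] at h2 h4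
      convert zero_mem (facePrime k (arc h i ∩ arc h (i + 1))) using 1
      simp only [h4, h3]
      split_ifs at * <;> first | omega | simp
    · exact Ideal.mul_mem_right _ _ (X_mem_facePrime.2 hv)
  | zero => exact ⟨0, fun i => by simp⟩
  | add x y _ _ hx hy =>
    obtain ⟨τ, hτ⟩ := hx
    obtain ⟨τ', hτ'⟩ := hy
    refine ⟨τ + τ', fun i => ?_⟩
    convert add_mem (hτ i) (hτ' i) using 1
    simp only [Pi.add_apply]
    ring
  | smul c x _ hx =>
    obtain ⟨τ, hτ⟩ := hx
    refine ⟨fun i => c * τ i, fun i => ?_⟩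
    convert Ideal.mul_mem_left _ c (hτ i) using 1
    rw [smul_eq_mul]
    ring

lemma exists_boundary_notMem [DecidableEq V] {s : MvPolynomial V k}
    (hs : s ∉ facePrime k (∅ : Finset V)) (τ : Fin (2 * d + 1) → MvPolynomial V k) :
    ∃ i, τ (i + 1) - τ i - s * (if i + 1 = 0 then 1 else 0) ∉
      facePrime k (arc h i ∩ arc h (i + 1)) := by
  by_contra! hc
  refine hs ?_
  have h1 := sum_mem fun i (_ : i ∈ Finset.univ) =>
    facePrime_anti (k := k) (Finset.empty_subset _) (hc i)
  have hshift (f : Fin (2 * d + 1) → MvPolynomial V k) : ∑ i, f (i + 1) = ∑ i, f i :=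
    Equiv.sum_comp (Equiv.addRight 1) f
  rw [Finset.sum_sub_distrib, Finset.sum_sub_distrib, hshift, sub_self, zero_sub, neg_mem_iff,
    ← Finset.mul_sum, hshift fun i => if i = 0 then 1 else 0] at h1
  simpa using h1

end Arc

section Origin

variable {k : Type*} [Field k] {V : Type*}

lemma exists_ltSeries_facePrime (l : ℕ) (F : Finset V) (hl : l ≤ F.card) :
    ∃ c : LTSeries (PrimeSpectrum (MvPolynomial V k)), c.length = l ∧
      c.head = ⟨facePrime k F, inferInstance⟩ ∧ c.last.asIdeal ≤ facePrime k (∅ : Finset V) := by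
  classical
  induction l generalizing F with
  | zero =>
    exact ⟨RelSeries.singleton _ ⟨facePrime k F, inferInstance⟩, rfl, rfl,
      facePrime_anti (Finset.empty_subset F)⟩
  | succ l ih =>
    obtain ⟨i, hi⟩ : F.Nonempty := Finset.card_pos.1 (by omega)
    obtain ⟨c, hc, hhead, hlast⟩ := ih (F.erase i) (by rw [Finset.card_erase_of_mem hi]; omega)
    have hlt : (⟨facePrime k F, inferInstance⟩ : PrimeSpectrum (MvPolynomial V k)) < c.head := by
      rw [hhead]
      exact facePrime_erase_lt hi
    exact ⟨c.cons _ hlt, by simp [hc], RelSeries.head_cons _ _ _, by simpa using hlast⟩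

lemma IsSerreMod.exists_locReg_origin {J : Ideal (MvPolynomial V k)} {r : ℕ}
    (hS : IsSerreMod r (MvPolynomial V k) (subquot J ⊤)) {F : Finset V} (hJF : J ≤ facePrime k F)
    {l : ℕ} (hlr : l ≤ r) (hlF : l ≤ F.card) :
    ∃ a : ℕ → MvPolynomial V k, (∀ i < l, a i ∈ facePrime k (∅ : Finset V)) ∧
      ∀ i < l, LocReg (facePrime k (∅ : Finset V)) (J ⊔ Ideal.span (a '' {j | j < i})) (a i) := by
  obtain ⟨c, rfl, hhead, hlast⟩ := exists_ltSeries_facePrime (k := k) l F hlF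
  exact hS.exists_locReg _ c (by rwa [hhead]) hlast hlr le_rfl

variable {Δ : Set (Finset V)} {d : ℕ}

/-- A complex with exactly two facets of maximal dimension, which are disjoint, is not
sequentially `S_2`. -/
lemma not_isSeqSerre_of_disjoint [Finite V] (hΔ : IsComplex Δ) (hd : HasDim Δ d)
    (h2 : 2 ≤ d) {A B : Finset V} (hA : A ∈ Δ) (hAd : A.card = d) (hB : B ∈ Δ) (hBd : B.card = d)
    (hAB : Disjoint A B) (htop : ∀ F ∈ Δ, F.card = d → F = A ∨ F = B) {r : ℕ} (hr : 2 ≤ r) :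
    ¬ IsSeqSerre k Δ r := by
  intro h
  have hmem : ∀ x, x ∈ topIdeal k Δ d ↔ x ∈ facePrime k A ∧ x ∈ facePrime k B := fun x => by
    rw [mem_topIdeal]
    refine ⟨fun h => ⟨h A hA hAd, h B hB hBd⟩, fun h F hF hFd => ?_⟩
    obtain rfl | rfl := htop F hF hFd
    exacts [h.1, h.2]
  obtain ⟨a, ha, hra⟩ := (h.topIdeal hΔ hd hr).exists_locReg_origin (F := A)
    (fun x hx => ((hmem x).1 hx).1) hr (h2.trans hAd.ge)
  have hsup : facePrime k A ⊔ facePrime k B = facePrime k (∅ : Finset V) := by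
    refine le_antisymm (sup_le (facePrime_anti (Finset.empty_subset _))
      (facePrime_anti (Finset.empty_subset _))) (facePrime_le_iff.2 fun i _ => ?_)
    by_cases hi : i ∈ A
    · exact Ideal.mem_sup_right (X_mem_facePrime.2 (Finset.disjoint_left.1 hAB hi))
    · exact Ideal.mem_sup_left (X_mem_facePrime.2 hi)
  have hexists : ∀ S T : Finset V, T.card = d → Disjoint S T →
      ∃ i, (X i : MvPolynomial V k) ∈ facePrime k S ∧ X i ∉ facePrime k T := by
    intro S T hT hST
    obtain ⟨i, hi⟩ : T.Nonempty := Finset.card_pos.1 (by omega)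
    exact ⟨i, X_mem_facePrime.2 (Finset.disjoint_right.1 hST hi), fun h => X_mem_facePrime.1 h hi⟩
  have hr0 : LocReg (facePrime k (∅ : Finset V)) (topIdeal k Δ d) (a 0) := by
    simpa using hra 0 two_pos
  have hr1 : LocReg (facePrime k (∅ : Finset V)) (topIdeal k Δ d ⊔ Ideal.span {a 0}) (a 1) := by
    have := hra 1 one_lt_two
    have h1 : {j : ℕ | j < 1} = {0} := by ext; simp
    rwa [h1, Set.image_singleton] at this
  refine not_sup_le_of_locReg (K := facePrime k A) (L := facePrime k B)
    (IsNoetherian.noetherian _) (IsNoetherian.noetherian _)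
    (fun x hx y hy => (hmem _).2 ⟨Ideal.mul_mem_right _ _ hx, Ideal.mul_mem_left _ _ hy⟩)
    (fun f hf => ?_) (fun f hf => ?_) (hsup ▸ ha 0 two_pos) (hsup ▸ ha 1 one_lt_two) hr0 hr1 hsup.le
  · obtain ⟨i, hi, hi'⟩ := hexists B A hAd hAB.symm
    exact (Ideal.IsPrime.mem_or_mem inferInstance ((hmem _).1 (hf _ hi)).1).resolve_right hi'
  · obtain ⟨i, hi, hi'⟩ := hexists A B hBd hAB
    exact (Ideal.IsPrime.mem_or_mem inferInstance ((hmem _).1 (hf _ hi)).2).resolve_right hi'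

/-- A complex whose faces of maximal dimension are the `2 * d + 1` arcs of length `d ≥ 3` of a cycle
is not sequentially `S_3`. -/
lemma not_isSeqSerre_of_arc [Fintype V] (hΔ : IsComplex Δ) (hd : HasDim Δ d) (h3 : 3 ≤ d)
    (h : V ≃ Fin (2 * d + 1)) (harc : ∀ i, arc h i ∈ Δ)
    (htop : ∀ F ∈ Δ, F.card = d → ∃ i, F = arc h i) {r : ℕ} (hr : 3 ≤ r) :
    ¬ IsSeqSerre k Δ r := by
  classical
  intro hseq
  have hmem : ∀ x, x ∈ topIdeal k Δ d ↔ ∀ i, x ∈ facePrime k (arc h i) := fun x => by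
    rw [mem_topIdeal]
    refine ⟨fun h i => h _ (harc i) card_arc, fun h F hF hFd => ?_⟩
    obtain ⟨i, rfl⟩ := htop F hF hFd
    exact h i
  obtain ⟨a, ha, hra⟩ := (hseq.topIdeal hΔ hd (by omega)).exists_locReg_origin (F := arc h 0)
    (fun x hx => (hmem x).1 hx 0) hr (h3.trans card_arc.ge)
  have hr0 : LocReg (facePrime k (∅ : Finset V)) (topIdeal k Δ d) (a 0) := by
    simpa using hra 0 (by norm_num)
  have hr1 : LocReg (facePrime k (∅ : Finset V)) (topIdeal k Δ d ⊔ Ideal.span {a 0}) (a 1) := by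
    have := hra 1 (by norm_num)
    have h1 : {j : ℕ | j < 1} = {0} := by ext; simp
    rwa [h1, Set.image_singleton] at this
  have hr2 : LocReg (facePrime k (∅ : Finset V))
      (topIdeal k Δ d ⊔ Ideal.span {a 0, a 1}) (a 2) := by
    have := hra 2 (by norm_num)
    have h1 : {j : ℕ | j < 2} = {0, 1} := by ext j; simp; omega
    rwa [h1, Set.image_pair] at this
  have hself : ∀ i, h.symm i ∈ arc h i := fun i => by simp [mem_arc]; omega
  have hval : (1 : Fin (2 * d + 1)).val = 1 := val_one_of_pos (by omega)
  have hsucc : ∀ i, h.symm (i + 1) ∈ arc h i := fun i => by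
    simp only [mem_arc, Equiv.apply_symm_apply, add_sub_cancel_left, hval]
    omega
  have hne : ∀ i, h.symm (i + 1) ≠ h.symm i := fun i hi => by
    have h1 : (1 : Fin (2 * d + 1)) = 0 := by simpa using h.symm.injective hi
    rw [h1] at hval
    simp at hval
  refine false_of_locReg_cycle (fun i => i + 1) (fun i => if i + 1 = 0 then 1 else 0)
    (fun i => facePrime k (arc h i)) (fun i => facePrime k (arc h i ∩ arc h (i + 1)))
    (facePrime k (∅ : Finset V)) (topIdeal k Δ d)
    (fun _ => inferInstance) (fun _ => inferInstance)
    (fun _ => facePrime_anti (Finset.empty_subset _))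
    (fun _ => facePrime_anti (Finset.empty_subset _))
    (fun _ => facePrime_anti Finset.inter_subset_left)
    (fun _ => facePrime_anti Finset.inter_subset_right) hmem
    (fun f hf => exists_sub_mem_facePrime (by omega) f hf)
    (fun y hy => exists_boundary (by omega) hy)
    (fun s hs τ => exists_boundary_notMem hs τ) (fun i => ?_) (fun i => ?_) (fun i => ?_)
    (ha 0 (by norm_num)) (ha 1 (by norm_num)) (ha 2 (by norm_num)) hr0 hr1 hr2
  · exact ⟨X (h.symm (i + 1)), X_mem_facePrime.2 (Finset.notMem_empty _), fun hX =>
      X_mem_facePrime.1 hX (Finset.mem_inter.2 ⟨hsucc i, hself _⟩)⟩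
  · refine ⟨X (h.symm i), X_mem_facePrime.2 (Finset.notMem_empty _), X (h.symm (i + 1)),
      X_mem_facePrime.2 (Finset.notMem_empty _), fun hX => X_mem_facePrime.1 hX (hself i), ?_⟩
    rw [← facePrime_erase]
    exact ⟨fun hX => X_mem_facePrime.1 hX (Finset.mem_erase.2 ⟨hne i, hsucc i⟩),
      facePrime_anti (Finset.empty_subset _), inferInstance⟩
  · refine ⟨∏ v ∈ arc h i, X v, prod_X_notMem_facePrime _, fun j hj => ?_⟩
    obtain ⟨v, hv, hvj⟩ := Finset.not_subset.1 fun hs : arc h i ⊆ arc h j =>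
      hj (eq_of_arc_subset (by omega) hs).symm
    exact prod_X_mem_iff.2 ⟨v, hv, X_mem_facePrime.2 hvj⟩

end Origin

lemma isComplex_indepComplex {V : Type*} (G : SimpleGraph V) : IsComplex (indepComplex G) :=
  fun _ hF _ hG x hx y hy => hF x (hG hx) y (hG hy)

section Cycle

variable {m : ℕ} [NeZero m] {S : Finset (Fin m)}

lemma cycleGraph_adj_iff (hm : 2 ≤ m) {u v : Fin m} :
    (SimpleGraph.cycleGraph m).Adj u v ↔ u = v + 1 ∨ v = u + 1 := by
  have h1 : (1 : Fin m).val = 1 := by rw [Fin.val_one', Nat.mod_eq_of_lt hm]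
  have key (a b : Fin m) : (a - b).val = 1 ↔ a = b + 1 := by
    rw [← sub_eq_iff_eq_add', Fin.ext_iff, h1]
  rw [SimpleGraph.cycleGraph_adj', key, key]

lemma mem_indepComplex_cycleGraph (hm : 2 ≤ m) :
    S ∈ indepComplex (SimpleGraph.cycleGraph m) ↔ ∀ x ∈ S, x + 1 ∉ S := by
  simp only [indepComplex, Set.mem_ofPred_eq, cycleGraph_adj_iff hm, not_or]
  refine ⟨fun h x hx hx' => (h x hx _ hx').2 rfl, fun h x hx y hy => ⟨?_, ?_⟩⟩
  · rintro rfl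
    exact h y hy hx
  · rintro rfl
    exact h x hx hy

lemma mem_map_addRight_one {x : Fin m} :
    x + 1 ∈ S.map (Equiv.addRight (1 : Fin m)).toEmbedding ↔ x ∈ S := by
  simp

lemma disjoint_map_addRight_one (hm : 2 ≤ m)
    (hS : S ∈ indepComplex (SimpleGraph.cycleGraph m)) :
    Disjoint S (S.map (Equiv.addRight (1 : Fin m)).toEmbedding) := by
  rw [mem_indepComplex_cycleGraph hm] at hS
  rw [Finset.disjoint_left]
  intro x hx hx'
  obtain ⟨y, hy, rfl⟩ := Finset.mem_map.1 hx'
  exact hS y hy hx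

lemma two_mul_card_le_of_mem_indepComplex (hm : 2 ≤ m)
    (hS : S ∈ indepComplex (SimpleGraph.cycleGraph m)) : 2 * S.card ≤ m := by
  have h := Finset.card_union_of_disjoint (disjoint_map_addRight_one hm hS)
  rw [Finset.card_map] at h
  have := Finset.card_le_univ (S ∪ S.map (Equiv.addRight (1 : Fin m)).toEmbedding)
  rw [Fintype.card_fin] at this
  omega

end Cycle

lemma val_add_one_of_two_le {m : ℕ} [NeZero m] (hm : 2 ≤ m) (v : Fin m) :
    (v + 1).val = if v.val + 1 = m then 0 else v.val + 1 := by
  rw [Fin.val_add, Fin.val_one', Nat.mod_eq_of_lt hm]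
  split_ifs with h
  · rw [h, Nat.mod_self]
  · exact Nat.mod_eq_of_lt (by omega)

lemma not_isSeqSerre_cycleGraph_even (k : Type*) [Field k] {d : ℕ} (hd : 2 ≤ d) :
    ¬ IsSeqSerre k (indepComplex (SimpleGraph.cycleGraph (2 * d))) 3 := by
  have : NeZero (2 * d) := ⟨by omega⟩
  have hm : 2 ≤ 2 * d := by omega
  set E : ℕ → Finset (Fin (2 * d)) := fun c => Finset.univ.filter fun v => v.val % 2 = c with hE
  have hval (v : Fin (2 * d)) : (v + 1).val % 2 = (v.val + 1) % 2 := by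
    rw [val_add_one_of_two_le hm]
    split_ifs <;> omega
  have hEmem (c : ℕ) : E c ∈ indepComplex (SimpleGraph.cycleGraph (2 * d)) := by
    rw [mem_indepComplex_cycleGraph hm]
    intro x hx hx'
    simp only [hE, Finset.mem_filter, Finset.mem_univ, true_and, hval] at hx hx'
    omega
  have hdisj : Disjoint (E 0) (E 1) := by
    rw [Finset.disjoint_left]
    intro x hx hx'
    simp only [hE, Finset.mem_filter, Finset.mem_univ, true_and] at hx hx'
    omega
  have hunion : E 0 ∪ E 1 = Finset.univ := by
    ext x
    simp only [hE, Finset.mem_union, Finset.mem_filter, Finset.mem_univ, true_and, iff_true]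
    omega
  have hcard := Finset.card_union_of_disjoint hdisj
  rw [hunion, Finset.card_univ, Fintype.card_fin] at hcard
  have h0 := two_mul_card_le_of_mem_indepComplex hm (hEmem 0)
  have h1 := two_mul_card_le_of_mem_indepComplex hm (hEmem 1)
  refine not_isSeqSerre_of_disjoint (d := d) (isComplex_indepComplex _)
    ⟨fun F hF => ?_, E 0, hEmem 0, by omega⟩ hd (hEmem 0) (by omega) (hEmem 1) (by omega) hdisj
    (fun F hF hFd => ?_) (by omega)
  · have := two_mul_card_le_of_mem_indepComplex hm hF
    omega
  · have hFd' := disjoint_map_addRight_one hm hF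
    have hu : F ∪ F.map (Equiv.addRight (1 : Fin (2 * d))).toEmbedding = Finset.univ := by
      rw [← Finset.card_eq_iff_eq_univ, Finset.card_union_of_disjoint hFd', Finset.card_map,
        Fintype.card_fin]
      omega
    have hstep (v : Fin (2 * d)) : v + 1 ∈ F ↔ v ∉ F := by
      have hv := Finset.mem_univ (v + 1)
      rw [← hu, Finset.mem_union, mem_map_addRight_one] at hv
      refine ⟨fun h h' => (mem_indepComplex_cycleGraph hm).1 hF v h' h, fun h => ?_⟩
      exact hv.resolve_right h
    have hpar (j : ℕ) (hj : j < 2 * d) :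
        (⟨j, hj⟩ : Fin (2 * d)) ∈ F ↔ (j % 2 = 0 ↔ (0 : Fin (2 * d)) ∈ F) := by
      induction j with
      | zero => simp [show (⟨0, hj⟩ : Fin (2 * d)) = 0 from rfl]
      | succ j ih =>
        have : (⟨j + 1, hj⟩ : Fin (2 * d)) = ⟨j, by omega⟩ + 1 := by
          rw [Fin.ext_iff, val_add_one_of_two_le hm]
          simp only
          split_ifs <;> omega
        rw [this, hstep, ih (by omega)]
        rcases Nat.mod_two_eq_zero_or_one j with h | h <;> simp [Nat.add_mod, h]
    by_cases hz : (0 : Fin (2 * d)) ∈ F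
    · left
      ext v
      have := hpar v.val v.isLt
      simp only [hE, Finset.mem_filter, Finset.mem_univ, true_and]
      simpa [hz] using this
    · right
      ext v
      have := hpar v.val v.isLt
      simp only [hE, Finset.mem_filter, Finset.mem_univ, true_and]
      simpa [hz] using this

section Odd

variable {d : ℕ}

lemma nsmul_eq_zero_of_fin {m : ℕ} [NeZero m] (v : Fin m) : m • v = 0 := by
  simpa using card_nsmul_eq_zero' (x := v)

lemma nsmul_add_self_fin (v : Fin (2 * d + 1)) : (d + 1) • (v + v) = v := by
  rw [← two_nsmul, ← mul_nsmul, show 2 * (d + 1) = (2 * d + 1) + 1 by ring, add_nsmul,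
    nsmul_eq_zero_of_fin, zero_add, one_nsmul]

/-- Division by two on `Fin (2 * d + 1)`, as a permutation. -/
def halving (d : ℕ) : Fin (2 * d + 1) ≃ Fin (2 * d + 1) where
  toFun v := (d + 1) • v
  invFun v := v + v
  left_inv v := (nsmul_add (M := Fin (2 * d + 1)) v v (d + 1)).symm.trans (nsmul_add_self_fin v)
  right_inv v := nsmul_add_self_fin v

lemma val_nsmul_one {m : ℕ} [NeZero m] {j : ℕ} (hj : j < m) : (j • (1 : Fin m)).val = j := by
  induction j with
  | zero => simp
  | succ j ih =>
    rw [succ_nsmul, Fin.val_add, ih (by omega), Fin.val_one', Nat.add_mod_mod, Nat.mod_eq_of_lt hj]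

lemma eq_nsmul_one {m : ℕ} [NeZero m] (v : Fin m) : v = v.val • (1 : Fin m) := by
  rw [Fin.ext_iff, val_nsmul_one v.isLt]

lemma arc_halving_mem_indepComplex (hd : 1 ≤ d) (i : Fin (2 * d + 1)) :
    arc (halving d) i ∈ indepComplex (SimpleGraph.cycleGraph (2 * d + 1)) := by
  rw [mem_indepComplex_cycleGraph (by omega)]
  intro x hx hx'
  rw [mem_arc] at hx hx'
  have h1 : (halving d (x + 1) - i) - (halving d x - i) = (d + 1) • (1 : Fin (2 * d + 1)) := by
    rw [sub_sub_sub_cancel_right]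
    simp [halving]
  have h2 := congrArg Fin.val h1
  rw [val_sub_eq_ite, val_nsmul_one (by omega)] at h2
  split_ifs at h2 <;> omega

lemma exists_eq_arc_halving (hd : 1 ≤ d) {S : Finset (Fin (2 * d + 1))}
    (hS : S ∈ indepComplex (SimpleGraph.cycleGraph (2 * d + 1))) (hSd : S.card = d) :
    ∃ i, S = arc (halving d) i := by
  have hm : 2 ≤ 2 * d + 1 := by omega
  have hdisj := disjoint_map_addRight_one hm hS
  obtain ⟨w, hw⟩ : ∃ w, (S ∪ S.map (Equiv.addRight (1 : Fin (2 * d + 1))).toEmbedding)ᶜ = {w} := by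
    rw [← Finset.card_eq_one, Finset.card_compl, Finset.card_union_of_disjoint hdisj,
      Finset.card_map, Fintype.card_fin]
    omega
  have hcase (v : Fin (2 * d + 1)) : v + 1 = w ∨ v + 1 ∈ S ∨ v ∈ S := by
    by_contra! h
    have : v + 1 ∈ (S ∪ S.map (Equiv.addRight (1 : Fin (2 * d + 1))).toEmbedding)ᶜ := by
      rw [Finset.mem_compl, Finset.mem_union, mem_map_addRight_one]
      tauto
    rw [hw, Finset.mem_singleton] at this
    exact h.1 this
  have hwS : w ∉ S := by
    have : w ∈ (S ∪ S.map (Equiv.addRight (1 : Fin (2 * d + 1))).toEmbedding)ᶜ := by simp [hw]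
    rw [Finset.mem_compl, Finset.mem_union] at this
    tauto
  rw [mem_indepComplex_cycleGraph hm] at hS
  have hone : (1 : Fin (2 * d + 1)) ≠ 0 := by
    intro h
    have := congrArg Fin.val h
    rw [val_one_of_pos hd] at this
    simp at this
  have hmem (j : ℕ) (hj : j < d) : w + (2 * j + 1) • (1 : Fin (2 * d + 1)) ∈ S := by
    induction j with
    | zero =>
      rcases hcase w with h | h | h
      · simp [hone] at h
      · simpa using h
      · exact absurd h hwS
    | succ j ih =>
      have h1 := ih (by omega)
      have h2 := hS _ h1
      have h3 : w + (2 * (j + 1) + 1) • (1 : Fin (2 * d + 1)) =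
          w + (2 * j + 1) • (1 : Fin (2 * d + 1)) + 1 + 1 := by
        rw [show 2 * (j + 1) + 1 = (2 * j + 1) + 1 + 1 by ring, succ_nsmul, succ_nsmul]
        abel
      rcases hcase (w + (2 * j + 1) • (1 : Fin (2 * d + 1)) + 1) with h | h | h
      · rw [← h3, add_eq_left] at h
        have := congrArg Fin.val h
        rw [val_nsmul_one (by omega)] at this
        simp at this
      · rwa [h3]
      · exact absurd h h2
  refine ⟨halving d (w + 1), (Finset.eq_of_subset_of_card_le (fun v hv => ?_) ?_).symm⟩
  · rw [mem_arc] at hv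
    have h1 : halving d v - halving d (w + 1) = (d + 1) • (v - (w + 1)) := by
      rw [nsmul_sub]
      rfl
    rw [h1] at hv
    have h2 := nsmul_add_self_fin (v - (w + 1))
    rw [nsmul_add, eq_nsmul_one ((d + 1) • (v - (w + 1))), ← add_nsmul] at h2
    have h3 := hmem _ hv
    rw [add_nsmul, two_mul ((d + 1) • (v - (w + 1))).val, h2, one_nsmul] at h3
    convert h3 using 1
    abel
  · rw [hSd, card_arc]

lemma not_isSeqSerre_cycleGraph_odd (k : Type*) [Field k] (hd : 3 ≤ d) :
    ¬ IsSeqSerre k (indepComplex (SimpleGraph.cycleGraph (2 * d + 1))) 3 := by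
  refine not_isSeqSerre_of_arc (isComplex_indepComplex _)
    ⟨fun F hF => ?_, _, arc_halving_mem_indepComplex (by omega) 0, card_arc⟩ hd (halving d)
    (arc_halving_mem_indepComplex (by omega))
    (fun F hF => exists_eq_arc_halving (by omega) hF) le_rfl
  have := two_mul_card_le_of_mem_indepComplex (by omega) hF
  omega

end Odd

lemma eq_three_or_five_of_isSeqSerre {k : Type*} [Field k] {n : ℕ} (hn : 3 ≤ n)
    (h : IsSeqSerre k (indepComplex (SimpleGraph.cycleGraph n)) 3) : n = 3 ∨ n = 5 := by
  rcases Nat.even_or_odd' n with ⟨d, rfl | rfl⟩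
  · exact absurd h (not_isSeqSerre_cycleGraph_even k (by omega))
  · by_contra hd
    exact not_isSeqSerre_cycleGraph_odd k (by omega) h

section RegPair

variable {R : Type*} [CommRing R]

lemma mk_mem_smul_top_iff {J K : Ideal R} {z : R} :
    (Submodule.Quotient.mk ⟨z, trivial⟩ : subquot J ⊤) ∈ (K • ⊤ : Submodule R (subquot J ⊤)) ↔
      z ∈ K ⊔ J := by
  obtain ⟨g, hg⟩ : ∃ g : subquot J ⊤, g = Submodule.Quotient.mk ⟨1, trivial⟩ := ⟨_, rfl⟩
  have hmk (w : R) : (Submodule.Quotient.mk ⟨w, trivial⟩ : subquot J ⊤) = w • g := by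
    rw [hg, ← Submodule.Quotient.mk_smul]
    congr 1
    ext
    simp
  have hzero (w : R) : (Submodule.Quotient.mk ⟨w, trivial⟩ : subquot J ⊤) = 0 ↔ w ∈ J := by
    rw [Submodule.Quotient.mk_eq_zero]
    rfl
  have htop : (⊤ : Submodule R (subquot J ⊤)) = Submodule.span R {g} := by
    refine (Submodule.eq_top_iff'.2 fun m => ?_).symm
    obtain ⟨⟨w, hw⟩, rfl⟩ := Submodule.Quotient.mk_surjective _ m
    exact hmk w ▸ Submodule.smul_mem _ w (Submodule.mem_span_singleton_self g)
  rw [htop, Submodule.mem_smul_span_singleton]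
  constructor
  · rintro ⟨y, hy, h⟩
    rw [hmk z, ← sub_eq_zero, ← sub_smul, ← hmk, hzero] at h
    rw [← sub_sub_cancel y z]
    exact sub_mem (Ideal.mem_sup_left hy) (Ideal.mem_sup_right h)
  · intro h
    obtain ⟨y, hy, w, hw, rfl⟩ := Submodule.mem_sup.1 h
    refine ⟨y, hy, ?_⟩
    rw [← sub_eq_zero, hmk (y + w), ← sub_smul, ← hmk, hzero]
    simpa using hw

lemma isSMulRegular_subquot_of_forall {J K : Ideal R} {a : R}
    (h : ∀ z, a * z ∈ K ⊔ J → z ∈ K ⊔ J) :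
    IsSMulRegular (subquot J ⊤ ⧸ (K • ⊤ : Submodule R (subquot J ⊤))) a := by
  rw [isSMulRegular_quotient_iff_mem_of_smul_mem]
  intro m hm
  obtain ⟨⟨w, _⟩, rfl⟩ := Submodule.Quotient.mk_surjective _ m
  rw [← Submodule.Quotient.mk_smul] at hm
  exact mk_mem_smul_top_iff.2 (h w (mk_mem_smul_top_iff.1 hm))

/-- The sequence `a, b` is weakly regular on `R ⧸ J`. -/
structure RegPair (a b : R) (J : Ideal R) : Prop where
  left : ∀ z, a * z ∈ J → z ∈ J
  right : ∀ z, b * z ∈ J ⊔ Ideal.span {a} → z ∈ J ⊔ Ideal.span {a}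

lemma RegPair.top (a b : R) : RegPair a b ⊤ := ⟨by simp, by simp⟩

lemma RegPair.of_colon {a b m : R} {J P : Ideal R} (h : RegPair a b (J ⊔ Ideal.span {m}))
    (hP : RegPair a b P) (hm : ∀ z, m * z ∈ J ↔ z ∈ P) : RegPair a b J := by
  refine ⟨fun z hz => ?_, fun z hz => ?_⟩
  · obtain ⟨w, hw⟩ := mem_sup_span_singleton.1 (h.left z (Ideal.mem_sup_left hz))
    have h1 : m * (a * w) ∈ J := by
      have := sub_mem hz (J.mul_mem_left a hw)
      convert this using 1
      ring
    have h2 := (hm w).2 (hP.left w ((hm _).1 h1))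
    simpa using add_mem hw h2
  · have h1 := h.right z ((sup_le_sup_right le_sup_left _ :
      J ⊔ Ideal.span {a} ≤ J ⊔ Ideal.span {m} ⊔ Ideal.span {a}) hz)
    obtain ⟨c, hc⟩ := mem_sup_span_singleton.1 h1
    obtain ⟨e, he⟩ := mem_sup_span_singleton.1 hc
    obtain ⟨w, hw⟩ := mem_sup_span_singleton.1 hz
    have h2 : a * (w - b * c) - b * (m * e) ∈ J := by
      have := sub_mem (J.mul_mem_left b he) hw
      convert this using 1
      ring
    have h3 : w - b * c ∈ J ⊔ Ideal.span {m} := by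
      refine h.left _ (mem_sup_span_singleton.2 ⟨b * e, ?_⟩)
      convert h2 using 1
      ring
    obtain ⟨v, hv⟩ := mem_sup_span_singleton.1 h3
    have h4 : m * (b * e - a * v) ∈ J := by
      have := sub_mem (J.mul_mem_left a hv) h2
      convert this using 1
      ring
    obtain ⟨u, hu⟩ := mem_sup_span_singleton.1
      (hP.right e (mem_sup_span_singleton.2 ⟨v, (hm _).1 h4⟩))
    refine mem_sup_span_singleton.2 ⟨c + m * u, ?_⟩
    have := add_mem he ((hm _).2 hu)
    convert this using 1
    ring

variable {J p : Ideal R} [p.IsPrime] {a b : R}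

lemma nontrivial_localizedModule_subquot (hJ : J ≤ p) :
    Nontrivial (LocalizedModule p.primeCompl (subquot J ⊤)) := by
  refine ⟨cyclicGen J p, 0, fun h => ?_⟩
  rw [← one_smul (Localization p.primeCompl) (cyclicGen J p), smul_cyclicGen_eq_zero_iff] at h
  have h1 := Ideal.map_mono (f := algebraMap R (Localization p.primeCompl)) hJ h
  rw [Localization.AtPrime.map_eq_maximalIdeal] at h1
  exact (Ideal.ne_top_iff_one _).1 (IsLocalRing.maximalIdeal.isMaximal _).ne_top h1

lemma length_le_depthIn_of_isWeaklyRegular (hJ : J ≤ p) {rs : List R}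
    (h : RingTheory.Sequence.IsWeaklyRegular (subquot J ⊤) rs) (hrs : ∀ r ∈ rs, r ∈ p) :
    (rs.length : ℕ∞) ≤ depthIn (Localization p.primeCompl)
      (Ideal.map (algebraMap R (Localization p.primeCompl)) p)
      (LocalizedModule p.primeCompl (subquot J ⊤)) := by
  have := nontrivial_localizedModule_subquot hJ
  have hfin : Module.Finite R (subquot J ⊤) := by
    have : Module.Finite R (⊤ : Ideal R) :=
      Module.Finite.of_fg ⟨{1}, by simp [Ideal.span_singleton_one]⟩
    infer_instance
  refine le_sSup ⟨rs.map (algebraMap R (Localization p.primeCompl)), fun x hx => ?_,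
    h.isRegular_of_isLocalizedModule_of_mem (Localization p.primeCompl) p
      (LocalizedModule.mkLinearMap p.primeCompl (subquot J ⊤)) hrs, by simp⟩
  obtain ⟨r, hr, rfl⟩ := List.mem_map.1 hx
  exact Ideal.mem_map_of_mem _ (hrs r hr)

lemma one_le_depthIn (hJ : J ≤ p) (ha : a ∈ p) (h : ∀ z, a * z ∈ J → z ∈ J) :
    1 ≤ depthIn (Localization p.primeCompl)
      (Ideal.map (algebraMap R (Localization p.primeCompl)) p)
      (LocalizedModule p.primeCompl (subquot J ⊤)) := by
  refine length_le_depthIn_of_isWeaklyRegular (rs := [a]) hJ ?_ (by simpa)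
  rw [RingTheory.Sequence.isWeaklyRegular_iff_Fin]
  intro i
  refine isSMulRegular_subquot_of_forall ?_
  fin_cases i
  simpa using h

lemma RegPair.two_le_depthIn (h : RegPair a b J) (hJ : J ≤ p) (ha : a ∈ p) (hb : b ∈ p) :
    2 ≤ depthIn (Localization p.primeCompl)
      (Ideal.map (algebraMap R (Localization p.primeCompl)) p)
      (LocalizedModule p.primeCompl (subquot J ⊤)) := by
  refine length_le_depthIn_of_isWeaklyRegular (rs := [a, b]) hJ ?_ (by simp [ha, hb])
  rw [RingTheory.Sequence.isWeaklyRegular_iff_Fin]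
  intro i
  refine isSMulRegular_subquot_of_forall ?_
  fin_cases i
  · simpa using h.left
  · simpa [sup_comm] using h.right

end RegPair

section Shelling

variable {k : Type*} [Field k] {V : Type*} {Δ : Set (Finset V)}

lemma mem_srIdeal_iff (hΔ : IsComplex Δ) {f : MvPolynomial V k} :
    f ∈ srIdeal k Δ ↔ ∀ F ∈ Δ, f ∈ facePrime k F := by
  refine ⟨fun hf F hF => srIdeal_le_facePrime hΔ hF hf, fun h => ?_⟩
  rw [f.as_sum]
  refine sum_mem fun m hm => ?_
  have hmF : m.support ∉ Δ := fun hF =>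
    mem_support_iff.1 hm (mem_facePrime.1 (h _ hF) m subset_rfl)
  have hmem : (∏ i ∈ m.support, X i : MvPolynomial V k) ∈ srIdeal k Δ :=
    Ideal.subset_span ⟨_, hmF, rfl⟩
  rw [monomial_eq]
  refine Ideal.mul_mem_left _ _ (Ideal.mem_of_dvd _ ?_ hmem)
  exact Finset.prod_dvd_prod_of_dvd _ _ fun i hi =>
    dvd_pow_self _ (Finsupp.mem_support_iff.1 hi)

lemma isHomogeneousIdeal_srIdeal (hΔ : IsComplex Δ) : IsHomogeneousIdeal k (srIdeal k Δ) := by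
  intro f hf i
  rw [mem_srIdeal_iff hΔ] at hf ⊢
  exact fun F hF => isHomogeneousIdeal_facePrime F f (hf F hF) i

lemma prod_X_mul_mem_srIdeal_iff (hΔ : IsComplex Δ) {F G : Finset V} (hF : F ∈ Δ) (hGF : G ⊆ F)
    (hG : ∀ H ∈ Δ, G ⊆ H → H ⊆ F) {z : MvPolynomial V k} :
    (∏ i ∈ G, X i) * z ∈ srIdeal k Δ ↔ z ∈ facePrime k F := by
  rw [mem_srIdeal_iff hΔ]
  have hmul (H : Finset V) : (∏ i ∈ G, X i) * z ∈ facePrime k H ↔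
      ¬ G ⊆ H ∨ z ∈ facePrime k H := by
    rw [(inferInstance : (facePrime k H).IsPrime).mul_mem_iff_mem_or_mem, prod_X_mem_iff,
      Finset.not_subset]
    simp only [X_mem_facePrime]
  simp only [hmul]
  refine ⟨fun h => (h F hF).resolve_left (not_not.2 hGF), fun h H hH => ?_⟩
  by_cases hGH : G ⊆ H
  · exact Or.inr (facePrime_anti (hG H hH hGH) h)
  · exact Or.inl hGH

lemma srIdeal_sup_span_prod_X (G : Finset V) :
    srIdeal k Δ ⊔ Ideal.span {∏ i ∈ G, X i} = srIdeal k {H ∈ Δ | ¬ G ⊆ H} := by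
  classical
  apply le_antisymm
  · refine sup_le (Ideal.span_mono ?_) ?_
    · rintro _ ⟨F, hF, rfl⟩
      exact ⟨F, fun h => hF h.1, rfl⟩
    · rw [Ideal.span_singleton_le_iff_mem]
      exact Ideal.subset_span ⟨G, fun h => h.2 subset_rfl, rfl⟩
  · rw [srIdeal, Ideal.span_le]
    rintro _ ⟨F, hF, rfl⟩
    by_cases hGF : G ⊆ F
    · exact Ideal.mem_sup_right
        (Ideal.mem_span_singleton.2 (Finset.prod_dvd_prod_of_subset _ _ _ hGF))
    · exact Ideal.mem_sup_left (Ideal.subset_span ⟨F, fun h => hF ⟨h, hGF⟩, rfl⟩)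

/-- One step of a shelling: `F` is a facet, and the faces of `F` containing `G` lie in no other
facet. -/
lemma RegPair.of_shelling_step (hΔ : IsComplex Δ) {F G : Finset V} {a b : MvPolynomial V k}
    (hreg : RegPair a b (srIdeal k {H ∈ Δ | ¬ G ⊆ H})) (hFreg : RegPair a b (facePrime k F))
    (hF : F ∈ Δ) (hGF : G ⊆ F) (hG : ∀ H ∈ Δ, G ⊆ H → H ⊆ F) : RegPair a b (srIdeal k Δ) :=
  .of_colon (by rwa [srIdeal_sup_span_prod_X]) hFreg
    fun _ => prod_X_mul_mem_srIdeal_iff hΔ hF hGF hG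

lemma IsComplex.sep_not_subset (hΔ : IsComplex Δ) (G : Finset V) :
    IsComplex {H ∈ Δ | ¬ G ⊆ H} :=
  fun F hF H hH => ⟨hΔ F hF.1 H hH, fun h => hF.2 (h.trans hH)⟩

lemma regPair_srIdeal_empty (a b : MvPolynomial V k) :
    RegPair a b (srIdeal k (∅ : Set (Finset V))) := by
  have : srIdeal k (∅ : Set (Finset V)) = ⊤ := by
    rw [Ideal.eq_top_iff_one]
    exact Ideal.subset_span ⟨∅, by simp, by simp⟩
  rw [this]
  exact .top a b

/-- The complex has a shelling with facets and restriction faces listed in reverse order. -/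
def IsShelling : Set (Finset V) → List (Finset V × Finset V) → Prop
  | Δ, [] => Δ = ∅
  | Δ, (F, G) :: l => F ∈ Δ ∧ G ⊆ F ∧ (∀ H ∈ Δ, G ⊆ H → H ⊆ F) ∧ IsShelling {H ∈ Δ | ¬ G ⊆ H} l

lemma IsShelling.regPair {a b : MvPolynomial V k} {l : List (Finset V × Finset V)}
    (hΔ : IsComplex Δ) (hl : IsShelling Δ l) (h : ∀ x ∈ l, RegPair a b (facePrime k x.1)) :
    RegPair a b (srIdeal k Δ) := by
  induction l generalizing Δ with
  | nil =>
    rw [show Δ = ∅ from hl]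
    exact regPair_srIdeal_empty a b
  | cons x l ih =>
    obtain ⟨hF, hGF, hG, hl⟩ := hl
    exact .of_shelling_step hΔ (ih (hΔ.sep_not_subset _) hl fun y hy => h y (by simp [hy]))
      (h x (by simp)) hF hGF hG

lemma IsShelling.exists_subset {l : List (Finset V × Finset V)}
    (hl : IsShelling Δ l) {H : Finset V} (hH : H ∈ Δ) : ∃ x ∈ l, H ⊆ x.1 := by
  induction l generalizing Δ with
  | nil =>
    rw [show Δ = ∅ from hl] at hH
    exact absurd hH (by simp)
  | cons x l ih =>
    obtain ⟨hF, hGF, hG, hl⟩ := hl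
    by_cases h : x.2 ⊆ H
    · exact ⟨x, by simp, hG H hH h⟩
    · obtain ⟨y, hy, hy'⟩ := ih hl ⟨hH, h⟩
      exact ⟨y, by simp [hy], hy'⟩

end Shelling

section Section

variable {k : Type*} [Field k] {V : Type*} {S : Type*} [CommRing S] [Algebra k S]

/-- The composite `S → k[V] → k[V] ⧸ facePrime k F` is an isomorphism, where the first map
is `φ`. -/
def IsSectionOn (φ : S →ₐ[k] MvPolynomial V k) (F : Finset V) : Prop :=
  ∃ ψ : MvPolynomial V k →ₐ[k] S, (∀ i ∉ F, ψ (X i) = 0) ∧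
    (∀ i ∈ F, X i - φ (ψ (X i)) ∈ facePrime k F) ∧ ∀ s, ψ (φ s) = s

variable {φ : S →ₐ[k] MvPolynomial V k} {F : Finset V}

lemma sub_mem_facePrime_of_forall {χ : MvPolynomial V k →ₐ[k] MvPolynomial V k}
    (h : ∀ i, X i - χ (X i) ∈ facePrime k F) (z : MvPolynomial V k) :
    z - χ z ∈ facePrime k F := by
  rw [← Ideal.Quotient.eq]
  have : Ideal.Quotient.mkₐ k (facePrime k F) = (Ideal.Quotient.mkₐ k (facePrime k F)).comp χ := by
    refine MvPolynomial.algHom_ext fun i => ?_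
    exact Ideal.Quotient.eq.2 (h i)
  exact DFunLike.congr_fun this z

lemma IsSectionOn.exists_retraction (h : IsSectionOn φ F) :
    ∃ ψ : MvPolynomial V k →ₐ[k] S, (∀ z ∈ facePrime k F, ψ z = 0) ∧
      (∀ z, z - φ (ψ z) ∈ facePrime k F) ∧ ∀ s, ψ (φ s) = s := by
  obtain ⟨ψ, h1, h2, h3⟩ := h
  refine ⟨ψ, fun z hz => ?_, ?_, h3⟩
  · exact (facePrime_le_iff (Q := RingHom.ker ψ)).2 (fun i hi => h1 i hi) hz
  · refine sub_mem_facePrime_of_forall (χ := φ.comp ψ) fun i => ?_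
    by_cases hi : i ∈ F
    · exact h2 i hi
    · rw [AlgHom.comp_apply, h1 i hi, map_zero, sub_zero]
      exact X_mem_facePrime.2 hi

lemma IsSectionOn.regPair (h : IsSectionOn φ F) {f g : S} (hfg : RegPair f g ⊥) :
    RegPair (φ f) (φ g) (facePrime k F) := by
  obtain ⟨ψ, h1, h2, h3⟩ := h.exists_retraction
  have hmem (z) : z ∈ facePrime k F ↔ ψ z = 0 :=
    ⟨h1 z, fun hz => by simpa [hz] using h2 z⟩
  refine ⟨fun z hz => ?_, fun z hz => ?_⟩
  · rw [hmem, map_mul, h3] at hz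
    exact (hmem z).2 (by simpa using hfg.left _ (by simpa using hz))
  · obtain ⟨w, hw⟩ := mem_sup_span_singleton.1 hz
    rw [hmem, map_sub, map_mul, map_mul, h3, h3] at hw
    obtain ⟨u, hu⟩ := mem_sup_span_singleton.1
      (hfg.right (ψ z) (mem_sup_span_singleton.2 ⟨ψ w, by simpa using hw⟩))
    refine mem_sup_span_singleton.2 ⟨φ u, (hmem _).2 ?_⟩
    rw [map_sub, map_mul, h3, h3]
    simpa using hu

/-- Primes containing `facePrime k F` are determined by their contraction along `φ`. -/
lemma IsSectionOn.comap_lt_comap (h : IsSectionOn φ F) {P Q : Ideal (MvPolynomial V k)}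
    (hP : facePrime k F ≤ P) (hPQ : P < Q) : P.comap φ < Q.comap φ := by
  obtain ⟨ψ, h1, h2, h3⟩ := h.exists_retraction
  refine lt_of_le_not_ge (Ideal.comap_mono hPQ.le) fun hle => hPQ.not_ge fun z hz => ?_
  have h4 : φ (ψ z) ∈ Q := by
    simpa using sub_mem hz (hPQ.le (hP (h2 z)))
  simpa using add_mem (hP (h2 z)) (hle h4 : φ (ψ z) ∈ P)

end Section

lemma Prime.regPair_bot {S : Type*} [CommRing S] [IsDomain S] {f g : S} (hf : Prime f)
    (hg : g ∉ Ideal.span {f}) : RegPair f g ⊥ := by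
  rw [Ideal.mem_span_singleton] at hg
  refine ⟨fun z hz => ?_, fun z hz => ?_⟩
  · simpa [hf.ne_zero] using hz
  · rw [bot_sup_eq, Ideal.mem_span_singleton] at hz ⊢
    exact (hf.dvd_or_dvd hz).resolve_left hg

section Serre

variable {k : Type*} [Field k] {V : Type*} [Finite V] {Δ : Set (Finset V)} {S : Type*} [CommRing S]
  [Algebra k S] {φ : S →ₐ[k] MvPolynomial V k} {l : List (Finset V × Finset V)}

lemma mDim_localizedModule_le_height (hl : IsShelling Δ l) (hφ : ∀ x ∈ l, IsSectionOn φ x.1)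
    (p : Ideal (MvPolynomial V k)) [p.IsPrime] :
    mDim (Localization p.primeCompl) (LocalizedModule p.primeCompl (subquot (srIdeal k Δ) ⊤)) ≤
      (p.comap φ).height := by
  rw [mDim_cyclic, ringKrullDim_quotient,
    ← IsLocalization.AtPrime.ringKrullDim_eq_height (p.comap φ) (Localization.AtPrime (p.comap φ))]
  let ep := IsLocalization.AtPrime.primeSpectrumOrderIso (Localization p.primeCompl) p
  let eq := IsLocalization.AtPrime.primeSpectrumOrderIso (Localization.AtPrime (p.comap φ))
    (p.comap φ)
  refine Order.krullDim_le_of_strictMono (fun x => eq.symm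
    ⟨PrimeSpectrum.comap (φ : S →+* MvPolynomial V k) (ep x.1).1,
      Ideal.comap_mono (f := φ) (ep x.1).2⟩) fun x y hxy => eq.symm.lt_iff_lt.2 ?_
  have hlt : (ep x.1).1.asIdeal < (ep y.1).1.asIdeal := ep.lt_iff_lt.2 hxy
  have hx : srIdeal k Δ ≤ (ep x.1).1.asIdeal :=
    Ideal.map_le_iff_le_comap.1 ((PrimeSpectrum.mem_zeroLocus _ _).1 x.2)
  obtain ⟨H, hH, hHx⟩ := exists_face_of_srIdeal_le hx
  obtain ⟨F, hF, hHF⟩ := hl.exists_subset hH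
  refine (hφ F hF).comap_lt_comap ((facePrime_anti hHF).trans (facePrime_le_iff.2
    fun i hi => ?_)) hlt
  by_contra h
  exact hi ((hHx i).2 h)

lemma isSerreMod_of_isShelling [IsDomain S] [UniqueFactorizationMonoid S] [IsNoetherianRing S]
    (hS : ringKrullDim S ≤ 2) (hΔ : IsComplex Δ) (hl : IsShelling Δ l)
    (hφ : ∀ x ∈ l, IsSectionOn φ x.1) (r : ℕ) :
    IsSerreMod r (MvPolynomial V k) (subquot (srIdeal k Δ) ⊤) := by
  intro p _
  by_cases hp : srIdeal k Δ ≤ p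
  swap
  · refine (min_le_right _ _).trans ?_
    rw [mDim_cyclic]
    have : (srIdeal k Δ).map (algebraMap _ (Localization p.primeCompl)) = ⊤ := by
      obtain ⟨z, hz, hzp⟩ := Set.not_subset.1 hp
      exact Ideal.eq_top_of_isUnit_mem _ (Ideal.mem_map_of_mem _ hz)
        (IsLocalization.map_units (Localization p.primeCompl) (⟨z, hzp⟩ : p.primeCompl))
    rw [this, ringKrullDim_eq_bot_of_subsingleton]
    exact bot_le
  refine (min_le_right _ _).trans ((mDim_localizedModule_le_height hl hφ p).trans
    (WithBot.coe_le_coe.2 ?_))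
  have hheight : (p.comap φ).height ≤ 2 := by
    refine WithBot.coe_le_coe.1 ((Ideal.height_le_ringKrullDim_of_ne_top
      (I := p.comap φ) Ideal.IsPrime.ne_top').trans hS)
  have hregPair {f g : S} (hfg : RegPair f g ⊥) : RegPair (φ f) (φ g) (srIdeal k Δ) :=
    hl.regPair hΔ fun x hx => (hφ x hx).regPair hfg
  by_cases hq : p.comap φ = ⊥
  · simp [hq]
  obtain ⟨f, hfq, hf⟩ := Ideal.IsPrime.exists_mem_prime_of_ne_bot inferInstance hq
  by_cases hfq' : p.comap φ ≤ Ideal.span {f}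
  · have heq : p.comap φ = Ideal.span {f} :=
      le_antisymm hfq' ((Ideal.span_singleton_le_iff_mem _).2 hfq)
    have hprinc : (p.comap φ).IsPrincipal := ⟨f, heq⟩
    have h1 : (p.comap φ).height ≤ 1 :=
      Ideal.height_le_one_of_isPrincipal_of_mem_minimalPrimes (p.comap φ) (p.comap φ)
        (by simp [Ideal.minimalPrimes_eq_subsingleton_self])
    refine h1.trans (one_le_depthIn hp hfq (hregPair (g := 1) ?_).left)
    exact Prime.regPair_bot hf fun h => hf.not_isUnit
      (isUnit_of_dvd_one (Ideal.mem_span_singleton.1 h))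
  · obtain ⟨g, hg, hgf⟩ := Set.not_subset.1 hfq'
    exact hheight.trans ((hregPair (Prime.regPair_bot hf hgf)).two_le_depthIn hp hfq hg)

lemma isSeqSerre_of_isShelling [IsDomain S] [UniqueFactorizationMonoid S] [IsNoetherianRing S]
    (hS : ringKrullDim S ≤ 2) (hΔ : IsComplex Δ) (hl : IsShelling Δ l) (hne : ∅ ∈ Δ)
    (hφ : ∀ x ∈ l, IsSectionOn φ x.1) (r : ℕ) : IsSeqSerre k Δ r := by
  have hlt : srIdeal k Δ < ⊤ :=
    lt_top_iff_ne_top.2 fun h => (inferInstance : (facePrime k (∅ : Finset V)).IsPrime).ne_top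
      (top_le_iff.1 (h ▸ srIdeal_le_facePrime hΔ hne))
  refine ⟨1, fun i => if i = 0 then srIdeal k Δ else ⊤, rfl, rfl, fun i _ => ?_, fun i hi => ?_,
    fun i hi => ?_, fun i hi => by omega⟩
  · dsimp only
    split_ifs
    · exact isHomogeneousIdeal_srIdeal hΔ
    · exact fun _ _ _ => trivial
  · obtain rfl : i = 0 := by omega
    simpa using hlt
  · obtain rfl : i = 0 := by omega
    exact isSerreMod_of_isShelling hS hΔ hl hφ r

end Serre


lemma ringKrullDim_mvPolynomial_fin_le_two (k : Type*) [Field k] {e : ℕ} (he : e ≤ 2) :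
    ringKrullDim (MvPolynomial (Fin e) k) ≤ 2 := by
  rw [MvPolynomial.ringKrullDim_of_isNoetherianRing, ringKrullDim_eq_zero_of_field, zero_add]
  simpa using (by exact_mod_cast he : (e : WithBot ℕ∞) ≤ 2)

lemma isShelling_cycleGraph_three : IsShelling (indepComplex (SimpleGraph.cycleGraph 3))
    [({0}, {0}), ({1}, {1}), ({2}, ∅)] := by
  have h (S : Finset (Fin 3)) := mem_indepComplex_cycleGraph (S := S) (by norm_num)
  simp only [IsShelling, Set.mem_ofPred_eq, h, Set.eq_empty_iff_forall_notMem]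
  and_intros <;> decide

lemma isShelling_cycleGraph_five : IsShelling (indepComplex (SimpleGraph.cycleGraph 5))
    [({0, 3}, {0, 3}), ({1, 3}, {3}), ({1, 4}, {1}), ({2, 4}, {4}), ({0, 2}, ∅)] := by
  have h (S : Finset (Fin 5)) := mem_indepComplex_cycleGraph (S := S) (by norm_num)
  simp only [IsShelling, Set.mem_ofPred_eq, h, Set.eq_empty_iff_forall_notMem]
  and_intros <;> decide

lemma isSectionOn_of_aeval {k : Type*} [Field k] {V : Type*} {e : ℕ}
    {c : Fin e → MvPolynomial V k} {F : Finset V} (b : V → MvPolynomial (Fin e) k)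
    (h0 : ∀ i ∉ F, b i = 0)
    (h1 : ∀ i ∈ F, Ideal.Quotient.mk (facePrime k F) (aeval c (b i)) =
      Ideal.Quotient.mk (facePrime k F) (X i))
    (h2 : ∀ j, aeval b (c j) = X j) : IsSectionOn (aeval c) F := by
  refine ⟨aeval b, fun i hi => by rw [aeval_X, h0 i hi],
    fun i hi => by rw [aeval_X]; exact Ideal.Quotient.eq.1 (h1 i hi).symm, fun s => ?_⟩
  have : (aeval b).comp (aeval c) = AlgHom.id k (MvPolynomial (Fin e) k) :=
    MvPolynomial.algHom_ext fun j => by simpa using h2 j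
  exact DFunLike.congr_fun this s

section SmallCycles

variable (k : Type*) [Field k]

lemma mk_facePrime_X_eq_zero {V : Type*} {F : Finset V} {i : V} (hi : i ∉ F) :
    Ideal.Quotient.mk (facePrime k F) (X i) = 0 :=
  Ideal.Quotient.eq_zero_iff_mem.2 (X_mem_facePrime.2 hi)

lemma isSeqSerre_cycleGraph_three :
    IsSeqSerre k (indepComplex (SimpleGraph.cycleGraph 3)) 3 := by
  refine isSeqSerre_of_isShelling (φ := aeval ![(X 0 + X 1 + X 2 : MvPolynomial (Fin 3) k)])
    (ringKrullDim_mvPolynomial_fin_le_two k (by norm_num)) (isComplex_indepComplex _)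
    isShelling_cycleGraph_three (by simp [indepComplex]) (fun x hx => ?_) 3
  fin_cases hx
  · refine isSectionOn_of_aeval ![X 0, 0, 0] ?_ ?_ ?_ <;>
      simp [Fin.forall_fin_succ, mk_facePrime_X_eq_zero]
  · refine isSectionOn_of_aeval ![0, X 0, 0] ?_ ?_ ?_ <;>
      simp [Fin.forall_fin_succ, mk_facePrime_X_eq_zero]
  · refine isSectionOn_of_aeval ![0, 0, X 0] ?_ ?_ ?_ <;>
      simp [Fin.forall_fin_succ, mk_facePrime_X_eq_zero]

lemma isSeqSerre_cycleGraph_five :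
    IsSeqSerre k (indepComplex (SimpleGraph.cycleGraph 5)) 3 := by
  refine isSeqSerre_of_isShelling
    (φ := aeval ![(X 0 + X 4 + X 3 : MvPolynomial (Fin 5) k), X 2 + X 1 + X 3])
    (ringKrullDim_mvPolynomial_fin_le_two k le_rfl) (isComplex_indepComplex _)
    isShelling_cycleGraph_five (by simp [indepComplex]) (fun x hx => ?_) 3
  fin_cases hx
  · refine isSectionOn_of_aeval ![X 0 - X 1, 0, 0, X 1, 0] ?_ ?_ ?_ <;>
      simp [Fin.forall_fin_succ, mk_facePrime_X_eq_zero]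
  · refine isSectionOn_of_aeval ![0, X 1 - X 0, 0, X 0, 0] ?_ ?_ ?_ <;>
      simp [Fin.forall_fin_succ, mk_facePrime_X_eq_zero]
  · refine isSectionOn_of_aeval ![0, X 1, 0, 0, X 0] ?_ ?_ ?_ <;>
      simp [Fin.forall_fin_succ, mk_facePrime_X_eq_zero]
  · refine isSectionOn_of_aeval ![0, 0, X 1, 0, X 0] ?_ ?_ ?_ <;>
      simp [Fin.forall_fin_succ, mk_facePrime_X_eq_zero]
  · refine isSectionOn_of_aeval ![X 0, 0, X 1, 0, 0] ?_ ?_ ?_ <;>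
      simp [Fin.forall_fin_succ, mk_facePrime_X_eq_zero]

end SmallCycles

/-- **Sequentially `S_3` cycles.**
Let `n ≥ 3` and let `C_n` be the cycle graph on `n` vertices.  Then `C_n` is
sequentially `S_3` over a field `k` if and only if `n = 3` or `n = 5`. -/
theorem cycleGraph_isSeqSerre_three_iff (k : Type*) [Field k] (n : ℕ)
    (hn : 3 ≤ n) :
    IsSeqSerre k (indepComplex (SimpleGraph.cycleGraph n)) 3 ↔ (n = 3 ∨ n = 5) := by
  refine ⟨eq_three_or_five_of_isSeqSerre hn, ?_⟩
  rintro (rfl | rfl)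
  · exact isSeqSerre_cycleGraph_three k
  · exact isSeqSerre_cycleGraph_five k

end SeqSr
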